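/- Let A be a finite family of polynomials in ℝ[X_1,…,X_k,T], and let C ⊆ ℝ^k × ℝ be a closed and bounded set which is a finite union of realizations of sign conditions on A. For t ∈ ℝ set C_t = {x ∈ ℝ^k : (x,t) ∈ C}. Suppose there exists t_0 > 0 such that C_t ⊆ C_{t'} whenever 0 < t < t' < t_0, and let B = ⋂_{0 < t < t_0} C_t. Then there exists t_1 ∈ (0, t_0) such that for every t ∈ (0, t_1), B ⊆ C_t and the inclusion B ↪ C_t is a homotopy equivalence. -/

import Mathlib

open MvPolynomial Set

theorem exists_orderIso_move {a b x y : ℝ} (hx : x ∈ Ioo a b) (hy : y ∈ Ioo a b) :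
    ∃ φ : ℝ ≃o ℝ, φ x = y ∧ ∀ u ∉ Ioo a b, φ u = u := by
  obtain ⟨hax, hxb⟩ := hx
  obtain ⟨hay, hyb⟩ := hy
  set τ : ℝ → ℝ := fun u => max 0 (min ((u - a) / (x - a)) ((b - u) / (b - x))) with hτ
  have hxa : 0 < x - a := by linarith
  have hbx : 0 < b - x := by linarith
  have hτ0 : ∀ u ∉ Ioo a b, τ u = 0 := by
    intro u hu
    refine max_eq_left ?_
    by_cases h : a < u
    · have : b ≤ u := by
        by_contra! h'
        exact hu ⟨h, h'⟩
      exact (min_le_right _ _).trans (div_nonpos_of_nonpos_of_nonneg (by linarith) hbx.le)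
    · exact (min_le_left _ _).trans (div_nonpos_of_nonpos_of_nonneg (by linarith) hxa.le)
  have hτc : Continuous τ := by fun_prop
  have hdec : ∀ u v, u < v → τ u - τ v ≤ (v - u) / (b - x) := by
    intro u v huv
    have h0 : 0 ≤ (v - u) / (b - x) := div_nonneg (by linarith) hbx.le
    rw [sub_le_iff_le_add]
    refine max_le (add_nonneg h0 (le_max_left _ _)) ?_
    rcases le_total ((v - a) / (x - a)) ((b - v) / (b - x)) with h | h
    · refine (min_le_left _ _).trans ?_
      have : (u - a) / (x - a) ≤ (v - a) / (x - a) := by gcongr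
      have h2 : (v - a) / (x - a) ≤ τ v := by
        simp only [hτ, min_eq_left h]; exact le_max_right _ _
      linarith
    · refine (min_le_right _ _).trans ?_
      have h2 : (b - v) / (b - x) ≤ τ v := by
        simp only [hτ, min_eq_right h]; exact le_max_right _ _
      have : (b - u) / (b - x) = (v - u) / (b - x) + (b - v) / (b - x) := by ring
      linarith
  have hinc : ∀ u v, u < v → τ v - τ u ≤ (v - u) / (x - a) := by
    intro u v huv
    have h0 : 0 ≤ (v - u) / (x - a) := div_nonneg (by linarith) hxa.le
    rw [sub_le_iff_le_add]
    refine max_le (add_nonneg h0 (le_max_left _ _)) ?_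
    rcases le_total ((u - a) / (x - a)) ((b - u) / (b - x)) with h | h
    · refine (min_le_left _ _).trans ?_
      have h2 : (u - a) / (x - a) ≤ τ u := by
        simp only [hτ, min_eq_left h]; exact le_max_right _ _
      have : (v - a) / (x - a) = (v - u) / (x - a) + (u - a) / (x - a) := by ring
      linarith
    · refine (min_le_right _ _).trans ?_
      have : (b - v) / (b - x) ≤ (b - u) / (b - x) := by gcongr
      have h2 : (b - u) / (b - x) ≤ τ u := by
        simp only [hτ, min_eq_right h]; exact le_max_right _ _
      linarith
  have hmono : StrictMono fun u => u + (y - x) * τ u := by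
    intro u v huv
    have hvu : 0 < v - u := by linarith
    simp only
    rcases le_total x y with h | h
    · have h1 := mul_le_mul_of_nonneg_left (hdec u v huv) (sub_nonneg.2 h)
      have h2 : (y - x) * ((v - u) / (b - x)) < v - u := by
        rw [← mul_div_assoc, div_lt_iff₀ hbx]
        nlinarith
      nlinarith
    · have h1 := mul_le_mul_of_nonneg_left (hinc u v huv) (sub_nonneg.2 h)
      have h2 : (x - y) * ((v - u) / (x - a)) < v - u := by
        rw [← mul_div_assoc, div_lt_iff₀ hxa]
        nlinarith
      nlinarith
  have hsurj : Function.Surjective fun u => u + (y - x) * τ u := by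
    refine Continuous.surjective (by fun_prop) ?_ ?_
    · refine Filter.tendsto_id.congr' ?_
      filter_upwards [Filter.eventually_ge_atTop b] with u hu
      rw [hτ0 u (fun h => not_lt.2 hu h.2)]; simp
    · refine Filter.tendsto_id.congr' ?_
      filter_upwards [Filter.eventually_le_atBot a] with u hu
      rw [hτ0 u (fun h => not_lt.2 hu h.1)]; simp
  refine ⟨hmono.orderIsoOfSurjective _ hsurj, ?_, fun u hu => ?_⟩
  · have : τ x = 1 := by simp [hτ, div_self hxa.ne', div_self hbx.ne']
    simp [this]
  · simp [hτ0 u hu]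

/-- A polynomial whose values on an order-connected set never vanish has constant sign there. -/
theorem sign_eval_eq_of_forall_ne_zero {p : Polynomial ℝ} {s : Set ℝ} (hs : s.OrdConnected)
    (h : ∀ u ∈ s, p.eval u ≠ 0) {u v : ℝ} (hu : u ∈ s) (hv : v ∈ s) :
    SignType.sign (p.eval u) = SignType.sign (p.eval v) := by
  have key : ∀ u ∈ s, ∀ v ∈ s, 0 < p.eval u → 0 < p.eval v := by
    intro u hu v hv hpos
    by_contra! hneg
    obtain ⟨w, hw, hw0⟩ := intermediate_value_uIcc (a := v) (b := u) (f := fun x => p.eval x)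
      p.continuous.continuousOn (mem_uIcc.2 (Or.inl ⟨hneg, hpos.le⟩))
    exact h w (hs.uIcc_subset hv hu hw) hw0
  rcases lt_or_gt_of_ne (h u hu) with h1 | h1 <;> rcases lt_or_gt_of_ne (h v hv) with h2 | h2
  · rw [sign_neg h1, sign_neg h2]
  · exact absurd (key v hv u hu h2) h1.not_gt
  · exact absurd (key u hu v hv h1) h2.not_gt
  · rw [sign_pos h1, sign_pos h2]

/-- If the derivative has no zero in `(a, b)`, a polynomial is strictly monotone or strictly
antitone on `[a, b]`. -/
theorem strictMonoOn_or_strictAntiOn_of_derivative_ne_zero {p : Polynomial ℝ} {a b : ℝ}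
    (h : ∀ u ∈ Ioo a b, p.derivative.eval u ≠ 0) :
    StrictMonoOn (fun u => p.eval u) (Icc a b) ∨ StrictAntiOn (fun u => p.eval u) (Icc a b) := by
  rcases (Ioo a b).eq_empty_or_nonempty with he | ⟨c, hc⟩
  · left
    intro u hu v hv huv
    exact absurd (show u ∈ Icc a b from hu) (by
      have : b ≤ a := not_lt.1 fun h => (nonempty_Ioo.2 h).ne_empty he
      intro _
      linarith [hu.1, hv.2])
  have hcst : ∀ u ∈ Ioo a b, SignType.sign (p.derivative.eval u) =
      SignType.sign (p.derivative.eval c) := fun u hu =>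
    sign_eval_eq_of_forall_ne_zero ordConnected_Ioo h hu hc
  rcases lt_or_gt_of_ne (h c hc) with h1 | h1
  · right
    refine strictAntiOn_of_deriv_neg (convex_Icc a b) p.continuous.continuousOn fun u hu => ?_
    rw [interior_Icc] at hu
    rw [Polynomial.deriv]
    have := hcst u hu
    rwa [sign_neg h1, sign_eq_neg_one_iff] at this
  · left
    refine strictMonoOn_of_deriv_pos (convex_Icc a b) p.continuous.continuousOn fun u hu => ?_
    rw [interior_Icc] at hu
    rw [Polynomial.deriv]
    have := hcst u hu
    rwa [sign_pos h1, sign_eq_one_iff] at this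

/-- If the derivative has no zero in `(a, b)` and `p` vanishes inside, then `p` changes sign from
`a` to `b`. -/
theorem eval_mul_eval_neg_of_root {p : Polynomial ℝ} {a b u : ℝ}
    (h : ∀ u ∈ Ioo a b, p.derivative.eval u ≠ 0) (hu : u ∈ Ioo a b) (hpu : p.eval u = 0) :
    p.eval a * p.eval b < 0 := by
  have ha : a ∈ Icc a b := ⟨le_rfl, (hu.1.trans hu.2).le⟩
  have hb : b ∈ Icc a b := ⟨(hu.1.trans hu.2).le, le_rfl⟩
  have hu' : u ∈ Icc a b := ⟨hu.1.le, hu.2.le⟩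
  rcases strictMonoOn_or_strictAntiOn_of_derivative_ne_zero h with hm | hm
  · have h1 := hm ha hu' hu.1
    have h2 := hm hu' hb hu.2
    simp only [hpu] at h1 h2
    exact mul_neg_of_neg_of_pos h1 h2
  · have h1 := hm ha hu' hu.1
    have h2 := hm hu' hb hu.2
    simp only [hpu] at h1 h2
    exact mul_neg_of_pos_of_neg h1 h2

theorem exists_root_of_eval_mul_eval_neg {p : Polynomial ℝ} {a b : ℝ} (hab : a < b)
    (h : p.eval a * p.eval b < 0) : ∃ u ∈ Ioo a b, p.eval u = 0 := by
  rcases mul_neg_iff.1 h with ⟨h1, h2⟩ | ⟨h1, h2⟩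
  · obtain ⟨u, hu, hu0⟩ := intermediate_value_Ioo' hab.le p.continuous.continuousOn
      (show (0 : ℝ) ∈ Ioo (p.eval b) (p.eval a) from ⟨h2, h1⟩)
    exact ⟨u, hu, hu0⟩
  · obtain ⟨u, hu, hu0⟩ := intermediate_value_Ioo hab.le p.continuous.continuousOn
      (show (0 : ℝ) ∈ Ioo (p.eval a) (p.eval b) from ⟨h1, h2⟩)
    exact ⟨u, hu, hu0⟩

theorem mul_neg_iff_of_sign_eq {a b c d : ℝ} (h₁ : SignType.sign a = SignType.sign c)
    (h₂ : SignType.sign b = SignType.sign d) : a * b < 0 ↔ c * d < 0 := by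
  rw [← sign_eq_neg_one_iff, ← sign_eq_neg_one_iff, sign_mul, sign_mul, h₁, h₂]

/-- Two neighbouring elements of a finite set around a point outside it. -/
theorem exists_neighbours_of_notMem {A : Finset ℝ} {lo hi u : ℝ} (hlo : lo ∈ A) (hhi : hi ∈ A)
    (h₁ : lo < u) (h₂ : u < hi) (hu : u ∉ A) :
    ∃ a ∈ A, ∃ b ∈ A, u ∈ Ioo a b ∧ ∀ c ∈ A, c ∉ Ioo a b := by
  obtain ⟨a, ha, hamax⟩ := (A.filter (· < u)).exists_max_image id ⟨lo, by simp [hlo, h₁]⟩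
  obtain ⟨b, hb, hbmin⟩ := (A.filter (u < ·)).exists_min_image id ⟨hi, by simp [hhi, h₂]⟩
  simp only [Finset.mem_filter, id] at *
  refine ⟨a, ha.1, b, hb.1, ⟨ha.2, hb.2⟩, fun c hc hcab => ?_⟩
  rcases lt_trichotomy c u with h | h | h
  · exact absurd (hamax c ⟨hc, h⟩) (not_le.2 hcab.1)
  · exact hu (h ▸ hc)
  · exact absurd (hbmin c ⟨hc, h⟩) (not_le.2 hcab.2)

theorem sign_table_extend_aux {ι : Type*} (f g : ι → Polynomial ℝ) (p q : Polynomial ℝ)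
    (hp : p ≠ 0) (hp' : ∃ i, f i = p.derivative ∧ g i = q.derivative ∧ f i ≠ 0) {lo hi : ℝ} (n : ℕ) :
    ∀ (A : Finset ℝ) (θ : ℝ ≃o ℝ),
      (∀ i u, SignType.sign ((f i).eval u) = SignType.sign ((g i).eval (θ u))) →
      (∀ i, f i ≠ 0 → ∀ u, (f i).eval u = 0 → u ∈ A) →
      (∀ a ∈ A, SignType.sign (p.eval a) = SignType.sign (q.eval (θ a))) →
      lo ∈ A → hi ∈ A →
      (∀ u, (u ≤ lo ∨ hi ≤ u) → SignType.sign (p.eval u) = SignType.sign (q.eval (θ u))) →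
      (p.roots.toFinset \ A).card = n →
      ∃ θ' : ℝ ≃o ℝ,
        (∀ i u, SignType.sign ((f i).eval u) = SignType.sign ((g i).eval (θ' u))) ∧
        ∀ u, SignType.sign (p.eval u) = SignType.sign (q.eval (θ' u)) := by
  obtain ⟨i₀, hfi, hgi, hi0⟩ := hp'
  have hfg0 : ∀ (θ : ℝ ≃o ℝ),
      (∀ i u, SignType.sign ((f i).eval u) = SignType.sign ((g i).eval (θ u))) →
      ∀ i u, (f i).eval u = 0 ↔ (g i).eval (θ u) = 0 := by
    intro θ h i u
    rw [← sign_eq_zero_iff, h, sign_eq_zero_iff]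
  have hder : ∀ (A : Finset ℝ) (θ : ℝ ≃o ℝ),
      (∀ i u, SignType.sign ((f i).eval u) = SignType.sign ((g i).eval (θ u))) →
      (∀ i, f i ≠ 0 → ∀ u, (f i).eval u = 0 → u ∈ A) → ∀ a b, (∀ c ∈ A, c ∉ Ioo a b) →
      (∀ u ∈ Ioo a b, p.derivative.eval u ≠ 0) ∧
        ∀ u ∈ Ioo (θ a) (θ b), q.derivative.eval u ≠ 0 := by
    intro A θ hθ hA a b hab
    refine ⟨fun u hu h0 => hab u (hA i₀ hi0 u (by rw [hfi, h0])) hu, fun u hu h0 => ?_⟩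
    have h1 : (f i₀).eval (θ.symm u) = 0 := by
      rw [hfg0 θ hθ, OrderIso.apply_symm_apply, hgi, h0]
    exact hab _ (hA i₀ hi0 _ h1) ⟨(θ.lt_symm_apply).2 hu.1, (θ.symm_apply_lt).2 hu.2⟩
  induction n with
  | zero =>
    intro A θ hθ hA hsign hlo hhi hout hcard
    refine ⟨θ, hθ, fun u => ?_⟩
    by_cases huA : u ∈ A
    · exact hsign u huA
    by_cases h1 : u ≤ lo ∨ hi ≤ u
    · exact hout u h1
    push Not at h1
    obtain ⟨a, ha, b, hb, hu, hab⟩ := exists_neighbours_of_notMem hlo hhi h1.1 h1.2 huA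
    obtain ⟨hd1, hd2⟩ := hder A θ hθ hA a b hab
    have hpn : ∀ v ∈ Ioo a b, p.eval v ≠ 0 := by
      intro v hv h0
      rw [Finset.card_eq_zero, Finset.sdiff_eq_empty_iff_subset] at hcard
      exact hab v (hcard (by simp [hp, h0])) hv
    have hqn : ∀ v ∈ Ioo (θ a) (θ b), q.eval v ≠ 0 := by
      intro v hv h0
      have h2 := eval_mul_eval_neg_of_root hd2 hv h0
      rw [← mul_neg_iff_of_sign_eq (hsign a ha) (hsign b hb)] at h2
      obtain ⟨w, hw, hw0⟩ := exists_root_of_eval_mul_eval_neg (hu.1.trans hu.2) h2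
      exact hpn w hw hw0
    have hθu : θ u ∈ Ioo (θ a) (θ b) := ⟨θ.strictMono hu.1, θ.strictMono hu.2⟩
    have hlt : a < b := hu.1.trans hu.2
    have hne : p.eval a ≠ 0 ∨ p.eval b ≠ 0 := by
      by_contra! h0
      have ha' : a ∈ Icc a b := ⟨le_rfl, hlt.le⟩
      have hb' : b ∈ Icc a b := ⟨hlt.le, le_rfl⟩
      rcases strictMonoOn_or_strictAntiOn_of_derivative_ne_zero hd1 with hm | hm
      · have := hm ha' hb' hlt
        simp [h0.1, h0.2] at this
      · have := hm ha' hb' hlt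
        simp [h0.1, h0.2] at this
    have hne0 : ∀ {c}, c ∈ A → p.eval c ≠ 0 → q.eval (θ c) ≠ 0 := by
      intro c hc h0 h3
      have := hsign c hc
      rw [h3, sign_zero, sign_eq_zero_iff] at this
      exact h0 this
    rcases hne with h0 | h0
    · have e1 : SignType.sign (p.eval u) = SignType.sign (p.eval a) :=
        sign_eval_eq_of_forall_ne_zero (s := Ico a b) ordConnected_Ico (fun v hv => by
          rcases hv.1.eq_or_lt with rfl | h
          · exact h0
          · exact hpn v ⟨h, hv.2⟩) ⟨hu.1.le, hu.2⟩ ⟨le_rfl, hlt⟩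
      have e2 : SignType.sign (q.eval (θ u)) = SignType.sign (q.eval (θ a)) :=
        sign_eval_eq_of_forall_ne_zero (s := Ico (θ a) (θ b)) ordConnected_Ico (fun v hv => by
          rcases hv.1.eq_or_lt with h | h
          · exact h ▸ hne0 ha h0
          · exact hqn v ⟨h, hv.2⟩) ⟨hθu.1.le, hθu.2⟩ ⟨le_rfl, hθu.1.trans hθu.2⟩
      rw [e1, e2, hsign a ha]
    · have e1 : SignType.sign (p.eval u) = SignType.sign (p.eval b) :=
        sign_eval_eq_of_forall_ne_zero (s := Ioc a b) ordConnected_Ioc (fun v hv => by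
          rcases hv.2.eq_or_lt with rfl | h
          · exact h0
          · exact hpn v ⟨hv.1, h⟩) ⟨hu.1, hu.2.le⟩ ⟨hlt, le_rfl⟩
      have e2 : SignType.sign (q.eval (θ u)) = SignType.sign (q.eval (θ b)) :=
        sign_eval_eq_of_forall_ne_zero (s := Ioc (θ a) (θ b)) ordConnected_Ioc (fun v hv => by
          rcases hv.2.eq_or_lt with h | h
          · exact h ▸ hne0 hb h0
          · exact hqn v ⟨hv.1, h⟩) ⟨hθu.1, hθu.2.le⟩ ⟨hθu.1.trans hθu.2, le_rfl⟩
      rw [e1, e2, hsign b hb]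
  | succ n ih =>
    intro A θ hθ hA hsign hlo hhi hout hcard
    obtain ⟨u, hu⟩ : (p.roots.toFinset \ A).Nonempty := by
      rw [← Finset.card_pos, hcard]; omega
    have hu' := hu
    simp only [Finset.mem_sdiff, Multiset.mem_toFinset, Polynomial.mem_roots hp,
      Polynomial.IsRoot.def] at hu
    obtain ⟨hpu, huA⟩ := hu
    by_cases h1 : u ≤ lo ∨ hi ≤ u
    · refine ih (insert u A) θ hθ (fun i hi v hv => Finset.mem_insert_of_mem (hA i hi v hv))
        (fun a ha => ?_) (Finset.mem_insert_of_mem hlo) (Finset.mem_insert_of_mem hhi) hout ?_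
      · rcases Finset.mem_insert.1 ha with rfl | ha
        · exact hout _ h1
        · exact hsign a ha
      · rw [Finset.sdiff_insert, Finset.card_erase_of_mem hu', hcard]; rfl
    push Not at h1
    obtain ⟨a, ha, b, hb, hu, hab⟩ := exists_neighbours_of_notMem hlo hhi h1.1 h1.2 huA
    obtain ⟨hd1, hd2⟩ := hder A θ hθ hA a b hab
    have h2 := eval_mul_eval_neg_of_root hd1 hu hpu
    rw [mul_neg_iff_of_sign_eq (hsign a ha) (hsign b hb)] at h2
    obtain ⟨v, hv, hqv⟩ := exists_root_of_eval_mul_eval_neg (θ.strictMono (hu.1.trans hu.2)) h2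
    have hθu : θ u ∈ Ioo (θ a) (θ b) := ⟨θ.strictMono hu.1, θ.strictMono hu.2⟩
    obtain ⟨φ, hφ, hφ'⟩ := exists_orderIso_move hθu hv
    have hφa : φ (θ a) = θ a := hφ' _ (by simp)
    have hφb : φ (θ b) = θ b := hφ' _ (by simp)
    have hstay : ∀ w ∉ Ioo a b, φ (θ w) = θ w := by
      intro w hw
      refine hφ' _ fun h => hw ⟨θ.lt_iff_lt.1 h.1, θ.lt_iff_lt.1 h.2⟩
    refine ih (insert u A) (θ.trans φ) ?_
      (fun i hi v hv => Finset.mem_insert_of_mem (hA i hi v hv))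
      (fun c hc => ?_) (Finset.mem_insert_of_mem hlo) (Finset.mem_insert_of_mem hhi)
      (fun w hw => ?_) ?_
    · intro i w
      rw [hθ, OrderIso.trans_apply]
      by_cases hw : w ∈ Ioo a b
      · by_cases hi0 : f i = 0
        · rw [← hθ, hi0, Polynomial.eval_zero, sign_zero, eq_comm, sign_eq_zero_iff]
          have := (hfg0 θ hθ i (θ.symm (φ (θ w)))).1 (by simp [hi0])
          simpa using this
        · refine sign_eval_eq_of_forall_ne_zero (s := Ioo (θ a) (θ b)) ordConnected_Ioo ?_
            ⟨θ.strictMono hw.1, θ.strictMono hw.2⟩ ⟨?_, ?_⟩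
          · intro z hz h0
            have h1 : (f i).eval (θ.symm z) = 0 := by
              rw [hfg0 θ hθ, OrderIso.apply_symm_apply, h0]
            exact hab _ (hA i hi0 _ h1) ⟨(θ.lt_symm_apply).2 hz.1, (θ.symm_apply_lt).2 hz.2⟩
          · rw [← hφa]; exact φ.strictMono (θ.strictMono hw.1)
          · rw [← hφb]; exact φ.strictMono (θ.strictMono hw.2)
      · rw [hstay w hw]
    · rw [OrderIso.trans_apply]
      rcases Finset.mem_insert.1 hc with rfl | hc
      · rw [hφ, hqv, hpu]
      · rw [hstay c (hab c hc), hsign c hc]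
    · rw [OrderIso.trans_apply, hstay w, hout w hw]
      intro hw'
      rcases hw with hw | hw
      · exact hab lo hlo ⟨hw'.1.trans_le hw, h1.1.trans hu.2⟩
      · exact hab hi hhi ⟨hu.1.trans h1.2, hw.trans_lt hw'.2⟩
    · rw [Finset.sdiff_insert, Finset.card_erase_of_mem hu', hcard]; rfl

theorem eventually_atTop_eval_mul_derivative_pos {p : Polynomial ℝ} (hp : p.derivative ≠ 0) :
    ∀ᶠ u in Filter.atTop, 0 < p.eval u * p.derivative.eval u := by
  have hp0 : p ≠ 0 := by rintro rfl; simp at hp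
  have hdeg : p.natDegree ≠ 0 := fun h => hp (Polynomial.derivative_of_natDegree_zero h)
  have hlc : p.derivative.leadingCoeff = p.leadingCoeff * p.natDegree :=
    Polynomial.leadingCoeff_derivative p
  have h1 : 0 < (p * p.derivative).degree := by
    rw [Polynomial.degree_mul, Polynomial.degree_eq_natDegree hp0,
      Polynomial.degree_eq_natDegree hp]
    have : 0 < p.natDegree + p.derivative.natDegree := by omega
    exact_mod_cast this
  have h2 : 0 ≤ (p * p.derivative).leadingCoeff := by
    rw [Polynomial.leadingCoeff_mul, hlc, ← mul_assoc]
    exact mul_nonneg (mul_self_nonneg _) (Nat.cast_nonneg _)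
  filter_upwards [(Polynomial.tendsto_atTop_of_leadingCoeff_nonneg _ h1 h2).eventually_gt_atTop 0]
    with u hu
  simpa using hu

theorem eventually_atBot_eval_mul_derivative_neg {p : Polynomial ℝ} (hp : p.derivative ≠ 0) :
    ∀ᶠ u in Filter.atBot, p.eval u * p.derivative.eval u < 0 := by
  have hd : (p.comp (-Polynomial.X)).derivative = -(p.derivative.comp (-Polynomial.X)) := by
    rw [Polynomial.derivative_comp]; simp
  have hne : (p.comp (-Polynomial.X)).derivative ≠ 0 := by
    rw [hd, neg_ne_zero]
    intro h
    apply hp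
    have := congrArg (fun r => Polynomial.comp r (-Polynomial.X)) h
    simpa [Polynomial.comp_assoc] using this
  have := Filter.tendsto_neg_atBot_atTop.eventually (eventually_atTop_eval_mul_derivative_pos hne)
  filter_upwards [this] with u hu
  rw [hd] at hu
  simp only [Polynomial.eval_comp, Polynomial.eval_neg, Polynomial.eval_X, neg_neg] at hu
  linarith

theorem sign_eq_of_mul_pos {a b c d : ℝ} (h₁ : 0 < a * b) (h₂ : 0 < c * d)
    (h : SignType.sign b = SignType.sign d) : SignType.sign a = SignType.sign c := by
  rcases mul_pos_iff.1 h₁ with ⟨ha, hb⟩ | ⟨ha, hb⟩ <;>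
  rcases mul_pos_iff.1 h₂ with ⟨hc, hd⟩ | ⟨hc, hd⟩
  · rw [sign_pos ha, sign_pos hc]
  · rw [sign_pos hb, sign_neg hd] at h; exact absurd h (by decide)
  · rw [sign_neg hb, sign_pos hd] at h; exact absurd h (by decide)
  · rw [sign_neg ha, sign_neg hc]

/-- Adjoining `p` and `q` to two families of polynomials with the same sign table. -/
theorem sign_table_extend {ι : Type*} [Finite ι] (f g : ι → Polynomial ℝ) (p q : Polynomial ℝ)
    {i₀ : ι} (hfi : f i₀ = p.derivative) (hgi : g i₀ = q.derivative)
    (hp : p.derivative ≠ 0) (hq : q.derivative ≠ 0) (θ : ℝ ≃o ℝ)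
    (hθ : ∀ i u, SignType.sign ((f i).eval u) = SignType.sign ((g i).eval (θ u)))
    (hroot : ∀ i, f i ≠ 0 → ∀ u, (f i).eval u = 0 →
      SignType.sign (p.eval u) = SignType.sign (q.eval (θ u))) :
    ∃ θ' : ℝ ≃o ℝ,
      (∀ i u, SignType.sign ((f i).eval u) = SignType.sign ((g i).eval (θ' u))) ∧
      ∀ u, SignType.sign (p.eval u) = SignType.sign (q.eval (θ' u)) := by
  classical
  have := Fintype.ofFinite ι
  have hp0 : p ≠ 0 := by rintro rfl; simp at hp
  have hder : ∀ u, SignType.sign (p.derivative.eval u) = SignType.sign (q.derivative.eval (θ u)) :=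
    fun u => by rw [← hfi, ← hgi, hθ]
  obtain ⟨hi, hhi⟩ := Filter.eventually_atTop.1
    ((eventually_atTop_eval_mul_derivative_pos hp).and
      (θ.tendsto_atTop.eventually (eventually_atTop_eval_mul_derivative_pos hq)))
  obtain ⟨lo, hlo⟩ := Filter.eventually_atBot.1
    ((eventually_atBot_eval_mul_derivative_neg hp).and
      (θ.tendsto_atBot.eventually (eventually_atBot_eval_mul_derivative_neg hq)))
  have hout : ∀ u, (u ≤ lo ∨ hi ≤ u) →
      SignType.sign (p.eval u) = SignType.sign (q.eval (θ u)) := by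
    rintro u (hu | hu)
    · obtain ⟨h1, h2⟩ := hlo u hu
      refine sign_eq_of_mul_pos (b := -p.derivative.eval u) (d := -q.derivative.eval (θ u))
        (by linarith) (by linarith) ?_
      rw [Left.sign_neg, Left.sign_neg, hder]
    · obtain ⟨h1, h2⟩ := hhi u hu
      exact sign_eq_of_mul_pos h1 h2 (hder u)
  refine sign_table_extend_aux f g p q hp0 ⟨i₀, hfi, hgi, hfi ▸ hp⟩ (lo := lo) (hi := hi) _
    (insert lo (insert hi (Finset.univ.biUnion fun i => (f i).roots.toFinset))) θ hθ ?_ ?_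
    (by simp) (by simp) hout rfl
  · intro i hi u hu
    simp only [Finset.mem_insert, Finset.mem_biUnion, Finset.mem_univ, true_and,
      Multiset.mem_toFinset]
    exact Or.inr (Or.inr ⟨i, (Polynomial.mem_roots hi).2 hu⟩)
  · intro a ha
    simp only [Finset.mem_insert, Finset.mem_biUnion, Finset.mem_univ, true_and,
      Multiset.mem_toFinset] at ha
    rcases ha with rfl | rfl | ⟨i, hi⟩
    · exact hout _ (Or.inl le_rfl)
    · exact hout _ (Or.inr le_rfl)
    · have hi0 : f i ≠ 0 := by
        intro h0; simp [h0] at hi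
      exact hroot i hi0 a ((Polynomial.mem_roots hi0).1 hi)

theorem exists_pseudo_division {R : Type*} [CommRing R] {g : Polynomial R} {j : ℕ}
    (hg : g.natDegree ≤ j + 1) (p : Polynomial R) :
    ∃ (m : ℕ) (s r : Polynomial R),
      Polynomial.C (g.coeff (j + 1) ^ m) * p = s * g + r ∧ r.natDegree ≤ j := by
  induction hn : p.natDegree using Nat.strong_induction_on generalizing p with
  | _ n ih =>
    by_cases hnj : n ≤ j
    · exact ⟨0, 0, p, by simp, hn ▸ hnj⟩
    set p' := Polynomial.C (g.coeff (j + 1)) * p -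
      Polynomial.C (p.coeff n) * Polynomial.X ^ (n - (j + 1)) * g with hp'
    have hdeg : p'.natDegree ≤ n := by
      refine (Polynomial.natDegree_sub_le _ _).trans (max_le ?_ ?_)
      · exact (Polynomial.natDegree_C_mul_le _ _).trans hn.le
      · refine Polynomial.natDegree_mul_le.trans ?_
        have := Polynomial.natDegree_C_mul_X_pow_le (p.coeff n) (n - (j + 1))
        omega
    have hcoeff : p'.coeff n = 0 := by
      have : n = (j + 1) + (n - (j + 1)) := by omega
      rw [hp', Polynomial.coeff_sub, Polynomial.coeff_C_mul, mul_assoc, Polynomial.coeff_C_mul]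
      nth_rewrite 4 [this]
      rw [Polynomial.coeff_X_pow_mul]
      ring
    have hlt : p'.natDegree < n := by
      refine lt_of_le_of_ne hdeg fun h => ?_
      have h0 : p' = 0 := by
        rw [← Polynomial.leadingCoeff_eq_zero, Polynomial.leadingCoeff, h, hcoeff]
      rw [h0] at h
      simp at h
      omega
    obtain ⟨m, s, r, h, hr⟩ := ih _ hlt p' rfl
    refine ⟨m + 1, s + Polynomial.C (g.coeff (j + 1) ^ m) * Polynomial.C (p.coeff n) *
      Polynomial.X ^ (n - (j + 1)), r, ?_, hr⟩
    have h2 : Polynomial.C (g.coeff (j + 1) ^ (m + 1)) * p =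
        Polynomial.C (g.coeff (j + 1) ^ m) * p' + Polynomial.C (g.coeff (j + 1) ^ m) *
          Polynomial.C (p.coeff n) * Polynomial.X ^ (n - (j + 1)) * g := by
      rw [hp', pow_succ, Polynomial.C_mul]
      ring
    rw [h2, h]
    ring

theorem exists_even_pseudo_division {R : Type*} [CommRing R] {g : Polynomial R} {j : ℕ}
    (hg : g.natDegree ≤ j + 1) (p : Polynomial R) :
    ∃ r : Polynomial R, r.natDegree ≤ j ∧ ∃ (m : ℕ) (s : Polynomial R),
      Polynomial.C (g.coeff (j + 1) ^ (2 * m)) * p = s * g + r := by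
  obtain ⟨m, s, r, h, hr⟩ := exists_pseudo_division hg p
  refine ⟨Polynomial.C (g.coeff (j + 1) ^ m) * r, (Polynomial.natDegree_C_mul_le _ _).trans hr, m,
    Polynomial.C (g.coeff (j + 1) ^ m) * s, ?_⟩
  rw [two_mul, pow_add, Polynomial.C_mul, mul_assoc, h]
  ring

/-- The signs of the elements of `G` determine the sign table of the univariate
polynomials in `F` after specialization of the coefficients. -/
def DeterminesSignTable {R : Type*} [CommRing R] (G : Finset R) (F : Finset (Polynomial R)) :
    Prop :=
  ∀ φ ψ : R →+* ℝ, (∀ c ∈ G, SignType.sign (φ c) = SignType.sign (ψ c)) →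
    ∃ θ : ℝ ≃o ℝ, ∀ f ∈ F, ∀ u,
      SignType.sign ((f.map φ).eval u) = SignType.sign ((f.map ψ).eval (θ u))

theorem exists_coeff_finset {R : Type*} [CommRing R] (F : Finset (Polynomial R)) :
    ∃ G : Finset R, ∀ φ ψ : R →+* ℝ, (∀ c ∈ G, SignType.sign (φ c) = SignType.sign (ψ c)) →
      ∀ f ∈ F, ∀ i, SignType.sign (φ (f.coeff i)) = SignType.sign (ψ (f.coeff i)) := by
  classical
  refine ⟨F.biUnion fun f => (Finset.range (f.natDegree + 1)).image f.coeff,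
    fun φ ψ h f hf i => ?_⟩
  by_cases hi : i ≤ f.natDegree
  · apply h
    simp only [Finset.mem_biUnion, Finset.mem_image, Finset.mem_range]
    exact ⟨f, hf, i, by omega, rfl⟩
  · rw [Polynomial.coeff_eq_zero_of_natDegree_lt (by omega)]
    simp

theorem truncated_map_eq {R : Type*} [CommRing R] (φ : R →+* ℝ) (f : Polynomial R) (j : ℕ)
    (h : ∀ i, j < i → φ (f.coeff i) = 0) :
    (∑ i ∈ Finset.range (j + 1), Polynomial.monomial i (f.coeff i)).map φ = f.map φ := by
  ext i
  rw [Polynomial.coeff_map, Polynomial.coeff_map, Polynomial.finsetSum_coeff]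
  simp only [Polynomial.coeff_monomial, Finset.sum_ite_eq', Finset.mem_range]
  split_ifs with hi
  · rfl
  · rw [h i (by omega), map_zero]

theorem sign_eval_eq_of_pseudo_remainder {p q r : Polynomial ℝ} {a : ℝ} {m : ℕ} {s : Polynomial ℝ}
    (ha : a ≠ 0) (h : Polynomial.C (a ^ (2 * m)) * p = s * q + r) {u : ℝ} (hu : q.eval u = 0) :
    SignType.sign (p.eval u) = SignType.sign (r.eval u) := by
  have h1 := congrArg (Polynomial.eval u) h
  simp only [Polynomial.eval_mul, Polynomial.eval_C, Polynomial.eval_add, hu, mul_zero,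
    zero_add] at h1
  have h2 : 0 < a ^ (2 * m) := by rw [pow_mul]; positivity
  rw [← h1, sign_mul, sign_pos h2, one_mul]

theorem exists_determinesSignTable_step {R : Type*} [CommRing R] {d : ℕ}
    (hd : ∀ F : Finset (Polynomial R), (∀ f ∈ F, f.natDegree ≤ d) →
      ∃ G, DeterminesSignTable G F)
    (H : Finset (Polynomial R)) (hH : ∀ f ∈ H, f.natDegree ≤ d + 1)
    (F : Finset (Polynomial R)) (hF : ∀ f ∈ F, f.natDegree ≤ d) (T : Finset (Polynomial R))
    (hT : ∀ f ∈ T, f ∈ F ∨ f ∈ H) :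
    ∃ G, DeterminesSignTable G T := by
  classical
  induction H using Finset.induction_on generalizing F T with
  | empty =>
    exact hd T fun f hf => hF f (by simpa using hT f hf)
  | insert p H _ ih =>
    have hp : p.natDegree ≤ d + 1 := hH p (Finset.mem_insert_self _ _)
    let tr : Polynomial R → ℕ → Polynomial R := fun f j =>
      ∑ i ∈ Finset.range (j + 1), Polynomial.monomial i (f.coeff i)
    have htr : ∀ f j, (tr f (j + 1)).natDegree ≤ j + 1 := fun f j =>
      Polynomial.natDegree_sum_le_of_forall_le _ _ fun i hi =>
        (Polynomial.natDegree_monomial_le _).trans (by simp at hi; omega)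
    have htrc : ∀ f j, (tr f j).coeff j = f.coeff j := fun f j => by
      simp [tr, Polynomial.coeff_monomial]
    choose rem hrem hrem' using fun f j => exists_even_pseudo_division (htr f j) p
    set F1 := F ∪ H ∪ {p.derivative} with hF1
    have hp' : p.derivative.natDegree ≤ d :=
      (Polynomial.natDegree_derivative_le p).trans (by omega)
    have hF1d : ∀ f ∈ F1, f.natDegree ≤ d + 1 := by
      intro f hf
      simp only [hF1, Finset.mem_union, Finset.mem_singleton] at hf
      rcases hf with (hf | hf) | rfl
      · exact (hF f hf).trans (by omega)
      · exact hH f (Finset.mem_insert_of_mem hf)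
      · omega
    set F2 := F ∪ {p.derivative, p.erase (d + 1)} ∪
      (F1 ×ˢ Finset.range (d + 1)).image (fun x => rem x.1 x.2) with hF2
    have hF2d : ∀ f ∈ F2, f.natDegree ≤ d := by
      intro f hf
      simp only [hF2, Finset.mem_union, Finset.mem_insert, Finset.mem_singleton, Finset.mem_image,
        Finset.mem_product, Finset.mem_range, Prod.exists] at hf
      rcases hf with (hf | rfl | rfl) | ⟨a, b, ⟨_, hb⟩, rfl⟩
      · exact hF f hf
      · exact hp'
      · rw [Polynomial.natDegree_le_iff_coeff_eq_zero]
        intro N hN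
        rw [Polynomial.coeff_erase]
        split_ifs with h
        · rfl
        · exact Polynomial.coeff_eq_zero_of_natDegree_lt (by omega)
      · exact (hrem a b).trans (by omega)
    obtain ⟨G, hG⟩ := ih (fun f hf => hH f (Finset.mem_insert_of_mem hf)) F2 hF2d (F2 ∪ H)
      fun f hf => Finset.mem_union.mp hf
    obtain ⟨G', hG'⟩ := exists_coeff_finset (F1 ∪ {p})
    refine ⟨G ∪ G', fun φ ψ h => ?_⟩
    have hc := hG' φ ψ fun c hc => h c (Finset.mem_union_right _ hc)
    obtain ⟨θ, hθ⟩ := hG φ ψ fun c hc => h c (Finset.mem_union_left _ hc)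
    have hTF1 : ∀ f ∈ T, f ∈ F1 ∨ f = p := by
      intro f hf
      have := hT f hf
      simp only [hF1, Finset.mem_union, Finset.mem_insert, Finset.mem_singleton] at this ⊢
      tauto
    have hF1F2 : ∀ f ∈ F1, f ∈ F2 ∪ H := by
      intro f hf
      simp only [hF1, hF2, Finset.mem_union, Finset.mem_insert, Finset.mem_singleton] at hf ⊢
      tauto
    have hpc := hc p (by simp) (d + 1)
    have key : ∃ θ' : ℝ ≃o ℝ,
        (∀ f ∈ F1, ∀ u,
          SignType.sign ((f.map φ).eval u) = SignType.sign ((f.map ψ).eval (θ' u))) ∧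
        ∀ u, SignType.sign ((p.map φ).eval u) = SignType.sign ((p.map ψ).eval (θ' u)) := by
      by_cases h0 : φ (p.coeff (d + 1)) = 0
      · have h0' : ψ (p.coeff (d + 1)) = 0 := by
          rw [h0, sign_zero] at hpc
          exact sign_eq_zero_iff.mp hpc.symm
        refine ⟨θ, fun f hf => hθ f (hF1F2 f hf), ?_⟩
        have he : ∀ χ : R →+* ℝ, χ (p.coeff (d + 1)) = 0 →
            p.map χ = (p.erase (d + 1)).map χ := by
          intro χ hχ
          ext i
          rw [Polynomial.coeff_map, Polynomial.coeff_map, Polynomial.coeff_erase]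
          split_ifs with hi
          · rw [hi, hχ, map_zero]
          · rfl
        rw [he φ h0, he ψ h0']
        exact hθ _ (by simp [hF2])
      · have h0' : ψ (p.coeff (d + 1)) ≠ 0 := fun h' => by
          rw [h', sign_zero] at hpc
          exact h0 (sign_eq_zero_iff.mp hpc)
        have hne : ∀ χ : R →+* ℝ, χ (p.coeff (d + 1)) ≠ 0 → (p.map χ).derivative ≠ 0 := by
          intro χ hχ hz
          have := congrArg (fun q => Polynomial.coeff q d) hz
          simp only [Polynomial.coeff_derivative, Polynomial.coeff_map,
            Polynomial.coeff_zero] at this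
          rcases mul_eq_zero.mp this with h | h
          · exact hχ h
          · exact absurd h (by positivity)
        have hroot : ∀ f ∈ F1, f.map φ ≠ 0 → ∀ u, (f.map φ).eval u = 0 →
            SignType.sign ((p.map φ).eval u) = SignType.sign ((p.map ψ).eval (θ u)) := by
          intro f hf hfne u hu
          have hnd : (f.map φ).natDegree ≤ d + 1 :=
            (Polynomial.natDegree_map_le).trans (hF1d f hf)
          have hcf := hc f (Finset.mem_union_left _ hf)
          obtain ⟨j, hj⟩ : ∃ j, (f.map φ).natDegree = j + 1 := by
            refine Nat.exists_eq_succ_of_ne_zero fun h => ?_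
            rw [Polynomial.eq_C_of_natDegree_eq_zero h, Polynomial.eval_C] at hu
            apply hfne
            rw [Polynomial.eq_C_of_natDegree_eq_zero h, hu, Polynomial.C_0]
          have ha : φ (f.coeff (j + 1)) ≠ 0 := by
            rw [← Polynomial.coeff_map, ← hj]
            exact Polynomial.leadingCoeff_ne_zero.mpr hfne
          have ha' : ψ (f.coeff (j + 1)) ≠ 0 := fun h' => by
            have := hcf (j + 1)
            rw [h', sign_zero] at this
            exact ha (sign_eq_zero_iff.mp this)
          have hz : ∀ i, j + 1 < i → φ (f.coeff i) = 0 := fun i hi => by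
            rw [← Polynomial.coeff_map]
            exact Polynomial.coeff_eq_zero_of_natDegree_lt (by omega)
          have hz' : ∀ i, j + 1 < i → ψ (f.coeff i) = 0 := fun i hi => by
            have := hcf i
            rw [hz i hi, sign_zero] at this
            exact sign_eq_zero_iff.mp this.symm
          have hu' : (f.map ψ).eval (θ u) = 0 := by
            have := hθ f (hF1F2 f hf) u
            rw [hu, sign_zero] at this
            exact sign_eq_zero_iff.mp this.symm
          obtain ⟨m, s, hs⟩ := hrem' f j
          rw [htrc] at hs
          have hmap : ∀ χ : R →+* ℝ, (∀ i, j + 1 < i → χ (f.coeff i) = 0) →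
              Polynomial.C (χ (f.coeff (j + 1)) ^ (2 * m)) * p.map χ =
                s.map χ * f.map χ + (rem f j).map χ := by
            intro χ hχ
            have := congrArg (Polynomial.map χ) hs
            rw [Polynomial.map_add, Polynomial.map_mul, Polynomial.map_mul, Polynomial.map_C,
              map_pow, truncated_map_eq χ f (j + 1) hχ] at this
            exact this
          rw [sign_eval_eq_of_pseudo_remainder ha (hmap φ hz) hu,
            sign_eval_eq_of_pseudo_remainder ha' (hmap ψ hz') hu']
          apply hθ
          apply Finset.mem_union_left
          rw [hF2]
          apply Finset.mem_union_right
          exact Finset.mem_image.mpr ⟨(f, j), by simp [hf]; omega, rfl⟩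
        obtain ⟨θ', h1, h2⟩ := sign_table_extend (ι := F1) (fun f => f.1.map φ)
          (fun f => f.1.map ψ) (p.map φ) (p.map ψ) (i₀ := ⟨p.derivative, by simp [hF1]⟩)
          (by simp [Polynomial.derivative_map]) (by simp [Polynomial.derivative_map])
          (hne φ h0) (hne ψ h0') θ (fun f u => hθ f.1 (hF1F2 f.1 f.2) u)
          (fun f => hroot f.1 f.2)
        exact ⟨θ', fun f hf u => h1 ⟨f, hf⟩ u, h2⟩
    obtain ⟨θ', h1, h2⟩ := key
    refine ⟨θ', fun f hf => ?_⟩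
    rcases hTF1 f hf with hf | rfl
    · exact h1 f hf
    · exact h2

theorem exists_determinesSignTable {R : Type*} [CommRing R] (F : Finset (Polynomial R)) :
    ∃ G, DeterminesSignTable G F := by
  classical
  have main : ∀ d : ℕ, ∀ F : Finset (Polynomial R), (∀ f ∈ F, f.natDegree ≤ d) →
      ∃ G, DeterminesSignTable G F := by
    intro d
    induction d with
    | zero =>
      intro F hF
      obtain ⟨G, hG⟩ := exists_coeff_finset F
      refine ⟨G, fun φ ψ h => ⟨OrderIso.refl ℝ, fun f hf u => ?_⟩⟩
      rw [Polynomial.eq_C_of_natDegree_le_zero (hF f hf)]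
      simpa using hG φ ψ h f hf 0
    | succ d ih =>
      intro F hF
      exact exists_determinesSignTable_step ih F hF ∅ (by simp) F (by simp)
  exact main (F.sup Polynomial.natDegree) F fun f hf => Finset.le_sup hf

/-- The substitution `X₀ ↦ X₀`, `Xᵢ ↦ Xᵢ + X₀ ^ (N ^ i)`. -/
noncomputable def shearHom (R : Type*) [CommRing R] (n N : ℕ) :
    MvPolynomial (Fin (n + 1)) R →ₐ[R] MvPolynomial (Fin (n + 1)) R :=
  aeval fun i => if i = 0 then X 0 else X i + X 0 ^ (N ^ (i : ℕ))

theorem finSuccEquiv_shearHom_X_zero (R : Type*) [CommRing R] (n N : ℕ) :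
    finSuccEquiv R n (shearHom R n N (X 0)) = Polynomial.X := by
  simp [shearHom, finSuccEquiv_X_zero]

theorem finSuccEquiv_shearHom_X_succ (R : Type*) [CommRing R] (n N : ℕ) (i : Fin n) :
    finSuccEquiv R n (shearHom R n N (X i.succ)) =
      Polynomial.X ^ (N ^ (i.succ : ℕ)) + Polynomial.C (X i) := by
  simp [shearHom, finSuccEquiv_X_zero, finSuccEquiv_X_succ, add_comm]

theorem natDegree_finSuccEquiv_shearHom_X {R : Type*} [CommRing R] [IsDomain R] (n N : ℕ)
    (i : Fin (n + 1)) : (finSuccEquiv R n (shearHom R n N (X i))).natDegree = N ^ (i : ℕ) := by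
  cases i using Fin.cases with
  | zero => simp [finSuccEquiv_shearHom_X_zero]
  | succ i => rw [finSuccEquiv_shearHom_X_succ, Polynomial.natDegree_X_pow_add_C]

theorem monic_finSuccEquiv_shearHom_X {R : Type*} [CommRing R] [IsDomain R] (n : ℕ) {N : ℕ}
    (hN : 0 < N) (i : Fin (n + 1)) : (finSuccEquiv R n (shearHom R n N (X i))).Monic := by
  cases i using Fin.cases with
  | zero => rw [finSuccEquiv_shearHom_X_zero]; exact Polynomial.monic_X
  | succ i =>
    rw [finSuccEquiv_shearHom_X_succ]
    exact Polynomial.monic_X_pow_add_C _ (by positivity)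

theorem finSuccEquiv_shearHom_monomial {R : Type*} [CommRing R] (n N : ℕ)
    (v : Fin (n + 1) →₀ ℕ) (a : R) :
    finSuccEquiv R n (shearHom R n N (monomial v a)) =
      Polynomial.C (C a) * ∏ i, finSuccEquiv R n (shearHom R n N (X i)) ^ v i := by
  rw [monomial_eq, Finsupp.prod_fintype _ _ fun i => pow_zero _]
  simp only [map_mul, map_prod, map_pow]
  congr 1
  simp [shearHom, finSuccEquiv_apply]

theorem natDegree_finSuccEquiv_shearHom_monomial {R : Type*} [CommRing R] [IsDomain R] (n : ℕ)
    {N : ℕ} (hN : 0 < N) (v : Fin (n + 1) →₀ ℕ) {a : R} (ha : a ≠ 0) :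
    (finSuccEquiv R n (shearHom R n N (monomial v a))).natDegree =
      ∑ i : Fin (n + 1), N ^ (i : ℕ) * v i := by
  have h : ∀ i ∈ Finset.univ, ((finSuccEquiv R n (shearHom R n N (X i))) ^ v i) ≠ 0 :=
    fun i _ => ((monic_finSuccEquiv_shearHom_X n hN i).pow _).ne_zero
  rw [finSuccEquiv_shearHom_monomial, Polynomial.natDegree_C_mul (by simpa using ha),
    Polynomial.natDegree_prod _ _ h]
  refine Finset.sum_congr rfl fun i _ => ?_
  rw [Polynomial.natDegree_pow, natDegree_finSuccEquiv_shearHom_X, mul_comm]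

theorem leadingCoeff_finSuccEquiv_shearHom_monomial {R : Type*} [CommRing R] [IsDomain R] (n : ℕ)
    {N : ℕ} (hN : 0 < N) (v : Fin (n + 1) →₀ ℕ) (a : R) :
    (finSuccEquiv R n (shearHom R n N (monomial v a))).leadingCoeff = C a := by
  have h : (∏ i, finSuccEquiv R n (shearHom R n N (X i)) ^ v i).Monic :=
    Polynomial.monic_prod_of_monic _ _ fun i _ => (monic_finSuccEquiv_shearHom_X n hN i).pow _
  rw [finSuccEquiv_shearHom_monomial, Polynomial.leadingCoeff_mul_monic h,
    Polynomial.leadingCoeff_C]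

theorem sum_pow_mul_ne_of_lt {n N : ℕ} (hN : 1 < N) {v w : Fin n → ℕ} (hv : ∀ i, v i < N)
    (hw : ∀ i, w i < N) (hne : v ≠ w) :
    ∑ i : Fin n, N ^ (i : ℕ) * v i ≠ ∑ i : Fin n, N ^ (i : ℕ) * w i := by
  intro h
  refine hne (List.ofFn_inj.mp ?_)
  apply Nat.ofDigits_inj_of_len_eq hN (by simp)
  · intro l hl
    obtain ⟨i, rfl⟩ := (List.mem_ofFn' _ _).mp hl
    exact hv i
  · intro l hl
    obtain ⟨i, rfl⟩ := (List.mem_ofFn' _ _).mp hl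
    exact hw i
  · simp only [Nat.ofDigits_eq_sum_mapIdx, List.mapIdx_eq_ofFn, List.get_ofFn, List.length_ofFn,
      Fin.val_cast, List.sum_ofFn, Fin.cast_cast, Fin.cast_eq_self]
    simpa only [mul_comm] using h

/-- After a suitable shear, the leading coefficient in the first variable is a nonzero constant. -/
theorem exists_leadingCoeff_finSuccEquiv_shearHom {R : Type*} [CommRing R] [IsDomain R] {n N : ℕ}
    {f : MvPolynomial (Fin (n + 1)) R} (hf : f ≠ 0) (hN : f.totalDegree + 2 ≤ N) :
    ∃ c : R, c ≠ 0 ∧ (finSuccEquiv R n (shearHom R n N f)).leadingCoeff = C c := by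
  have hN0 : 0 < N := by omega
  obtain ⟨v, vin, vs⟩ := Finset.exists_max_image f.support
    (fun v => ∑ i : Fin (n + 1), N ^ (i : ℕ) * v i) (support_nonempty.mpr hf)
  have hlt : ∀ w ∈ f.support, ∀ i, w i < N := fun w hw i =>
    lt_of_le_of_lt ((monomial_le_degreeOf i hw).trans (degreeOf_le_totalDegree f i)) (by omega)
  have hv0 := mem_support_iff.mp vin
  refine ⟨coeff v f, hv0, ?_⟩
  set h := fun w => finSuccEquiv R n (shearHom R n N (monomial w (coeff w f))) with hh
  have hdeg : ∀ w ∈ f.support, (h w).degree = ((∑ i : Fin (n + 1), N ^ (i : ℕ) * w i : ℕ)) := by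
    intro w hw
    have hw0 := mem_support_iff.mp hw
    rw [← natDegree_finSuccEquiv_shearHom_monomial n hN0 w hw0, Polynomial.degree_eq_natDegree]
    intro h0
    have := leadingCoeff_finSuccEquiv_shearHom_monomial n hN0 w (coeff w f)
    rw [hh] at h0
    simp only at h0
    rw [h0, Polynomial.leadingCoeff_zero] at this
    exact hw0 (C_injective _ _ (by rw [← this, C_0]))
  have hsum : finSuccEquiv R n (shearHom R n N f) = ∑ w ∈ f.support \ {v}, h w + h v := by
    nth_rw 1 [← f.support_sum_monomial_coeff]
    rw [map_sum, map_sum, Finset.sum_eq_add_sum_sdiff_singleton_of_mem vin, add_comm]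
  rw [hsum, Polynomial.leadingCoeff_add_of_degree_lt,
    leadingCoeff_finSuccEquiv_shearHom_monomial n hN0]
  refine (Polynomial.degree_sum_le _ _).trans_lt ?_
  rw [Finset.sup_lt_iff (by rw [hdeg v vin]; exact WithBot.bot_lt_coe _)]
  intro w hw
  obtain ⟨hw1, hw2⟩ := Finset.mem_sdiff.mp hw
  rw [hdeg w hw1, hdeg v vin]
  have := sum_pow_mul_ne_of_lt (by omega) (hlt w hw1) (hlt v vin)
    (fun h => hw2 (by simpa using DFunLike.coe_injective h))
  exact_mod_cast lt_of_le_of_ne (vs w hw1) this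

/-- The homeomorphism `x₀ ↦ x₀`, `xᵢ ↦ xᵢ + x₀ ^ (N ^ i)`. -/
noncomputable def shearHomeomorph (n N : ℕ) : (Fin (n + 1) → ℝ) ≃ₜ (Fin (n + 1) → ℝ) where
  toFun x := fun i => if i = 0 then x 0 else x i + x 0 ^ (N ^ (i : ℕ))
  invFun x := fun i => if i = 0 then x 0 else x i - x 0 ^ (N ^ (i : ℕ))
  left_inv x := by ext i; by_cases h : i = 0 <;> simp [h]
  right_inv x := by ext i; by_cases h : i = 0 <;> simp [h]
  continuous_toFun := by
    refine continuous_pi fun i => ?_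
    by_cases h : i = 0 <;> simp only [h, if_true, if_false] <;> fun_prop
  continuous_invFun := by
    refine continuous_pi fun i => ?_
    by_cases h : i = 0 <;> simp only [h, if_true, if_false] <;> fun_prop

theorem eval₂_shearHom {R : Type*} [CommRing R] (n N : ℕ) (φ : R →+* ℝ) (x : Fin (n + 1) → ℝ)
    (f : MvPolynomial (Fin (n + 1)) R) :
    eval₂Hom φ x (shearHom R n N f) = eval₂Hom φ (shearHomeomorph n N x) f := by
  induction f using MvPolynomial.induction_on with
  | C a => simp [shearHom]
  | add p q hp hq => rw [map_add, map_add, map_add, hp, hq]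
  | mul_X p i hp =>
    rw [map_mul, map_mul, map_mul, hp]
    congr 1
    by_cases h : i = 0 <;> simp [shearHom, shearHomeomorph, h]

/-- The sign of `v` is `s` or zero. -/
def RelSign (s : SignType) (v : ℝ) : Prop := SignType.sign v = 0 ∨ SignType.sign v = s

theorem relSign_zero_iff {v : ℝ} : RelSign 0 v ↔ v = 0 := by simp [RelSign]

theorem relSign_one_iff {v : ℝ} : RelSign 1 v ↔ 0 ≤ v := by
  rw [RelSign, sign_eq_zero_iff, sign_eq_one_iff]
  exact ⟨fun h => h.elim (fun h => h.ge) le_of_lt, fun h => (eq_or_lt_of_le h).imp_left Eq.symm⟩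

theorem relSign_neg_one_iff {v : ℝ} : RelSign (-1) v ↔ v ≤ 0 := by
  rw [RelSign, sign_eq_zero_iff, sign_eq_neg_one_iff]
  exact ⟨fun h => h.elim (fun h => h.le) le_of_lt, fun h => eq_or_lt_of_le h⟩

theorem setOf_relSign_eq (s : SignType) :
    {v | RelSign s v} = {0} ∨ {v | RelSign s v} = Iic 0 ∨ {v | RelSign s v} = Ici 0 := by
  cases s
  · exact Or.inl (Set.ext fun v => relSign_zero_iff)
  · exact Or.inr (Or.inl (Set.ext fun v => relSign_neg_one_iff))
  · exact Or.inr (Or.inr (Set.ext fun v => relSign_one_iff))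

theorem isClosed_setOf_relSign (s : SignType) : IsClosed {v | RelSign s v} := by
  rcases setOf_relSign_eq s with h | h | h <;> rw [h]
  exacts [isClosed_singleton, isClosed_Iic, isClosed_Ici]

theorem ordConnected_setOf_relSign (s : SignType) : OrdConnected {v | RelSign s v} := by
  rcases setOf_relSign_eq s with h | h | h <;> rw [h]
  exacts [ordConnected_singleton, ordConnected_Iic, ordConnected_Ici]

theorem monotoneOn_or_antitoneOn_of_relSign_derivative {p : Polynomial ℝ} {s : SignType} {a b : ℝ}
    (h : ∀ u ∈ Icc a b, RelSign s (p.derivative.eval u)) :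
    MonotoneOn (fun u => p.eval u) (Icc a b) ∨ AntitoneOn (fun u => p.eval u) (Icc a b) := by
  have hi := interior_subset (s := Icc a b)
  cases s
  · left
    refine monotoneOn_of_deriv_nonneg (convex_Icc a b) p.continuousOn
      p.differentiable.differentiableOn fun u hu => ?_
    rw [Polynomial.deriv]
    exact (relSign_zero_iff.mp (h u (hi hu))).ge
  · right
    refine antitoneOn_of_deriv_nonpos (convex_Icc a b) p.continuousOn
      p.differentiable.differentiableOn fun u hu => ?_
    rw [Polynomial.deriv]
    exact relSign_neg_one_iff.mp (h u (hi hu))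
  · left
    refine monotoneOn_of_deriv_nonneg (convex_Icc a b) p.continuousOn
      p.differentiable.differentiableOn fun u hu => ?_
    rw [Polynomial.deriv]
    exact relSign_one_iff.mp (h u (hi hu))

/-- Thom's lemma: a relaxed sign condition on a derivative-closed family of univariate
polynomials defines an interval. -/
theorem ordConnected_of_derivative_closed {J : Type*} {f : J → Polynomial ℝ}
    (hD : ∀ j, ∃ j', f j' = (f j).derivative) (τ : J → SignType) :
    OrdConnected {u | ∀ j, RelSign (τ j) ((f j).eval u)} := by
  refine ⟨fun a ha b hb u hu => ?_⟩
  have main : ∀ n : ℕ, ∀ j, (f j).natDegree ≤ n → ∀ u ∈ Icc a b,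
      RelSign (τ j) ((f j).eval u) := by
    intro n
    induction n with
    | zero =>
      intro j hj u _
      have := ha j
      rw [Polynomial.eq_C_of_natDegree_le_zero hj, Polynomial.eval_C] at this ⊢
      exact this
    | succ n ih =>
      intro j hj u hu
      obtain ⟨j', hj'⟩ := hD j
      have h' : ∀ v ∈ Icc a b, RelSign (τ j') ((f j).derivative.eval v) := by
        rw [← hj']
        refine ih j' ?_
        rw [hj']
        exact (Polynomial.natDegree_derivative_le _).trans (by omega)
      have hab := hu.1.trans hu.2
      rcases monotoneOn_or_antitoneOn_of_relSign_derivative h' with hm | hm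
      · exact (ordConnected_setOf_relSign (τ j)).out (ha j) (hb j)
          ⟨hm (left_mem_Icc.2 hab) hu hu.1, hm hu (right_mem_Icc.2 hab) hu.2⟩
      · exact (ordConnected_setOf_relSign (τ j)).out (hb j) (ha j)
          ⟨hm hu (right_mem_Icc.2 hab) hu.2, hm (left_mem_Icc.2 hab) hu hu.1⟩
  exact fun j => main _ j le_rfl u hu

theorem eq_zero_of_eval_eq_zero_on_Icc {p : Polynomial ℝ} {a b : ℝ} (hab : a < b)
    (h : ∀ u ∈ Icc a b, p.eval u = 0) : p = 0 :=
  Polynomial.eq_zero_of_infinite_isRoot p ((Icc_infinite hab).mono h)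

/-- A finite family of univariate polynomials depending on a parameter in `Y`. -/
structure PolySystem {Y J : Type*} [TopologicalSpace Y] (f : J → Y → Polynomial ℝ)
    (E : Set Y) : Prop where
  continuous_eval : ∀ j, Continuous fun p : Y × ℝ => (f j p.1).eval p.2
  zero_or_ne_zero : ∀ j, (∀ y ∈ E, f j y = 0) ∨ ∀ y ∈ E, f j y ≠ 0
  derivative_closed : ∀ j, ∃ j', ∀ y, f j' y = (f j y).derivative
  root_bound : ∃ b : Y → ℝ, ContinuousOn b E ∧
    ∀ j, ∀ y ∈ E, f j y ≠ 0 → ∀ u, (f j y).eval u = 0 → |u| ≤ b y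

/-- The fibre of a relaxed sign condition. -/
def relFiber {Y J : Type*} (f : J → Y → Polynomial ℝ) (τ : J → SignType) (y : Y) : Set ℝ :=
  {u | ∀ j, RelSign (τ j) ((f j y).eval u)}

/-- The fibre of a sign condition. -/
def signFiber {Y J : Type*} (f : J → Y → Polynomial ℝ) (τ : J → SignType) (y : Y) : Set ℝ :=
  {u | ∀ j, SignType.sign ((f j y).eval u) = τ j}

theorem signFiber_subset_relFiber {Y J : Type*} (f : J → Y → Polynomial ℝ) (τ : J → SignType)
    (y : Y) : signFiber f τ y ⊆ relFiber f τ y := fun _ hu j => Or.inr (hu j)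

namespace PolySystem

variable {Y J : Type*} [TopologicalSpace Y] {f : J → Y → Polynomial ℝ} {E : Set Y}

theorem ordConnected_relFiber (hf : PolySystem f E) (τ : J → SignType) (y : Y) :
    OrdConnected (relFiber f τ y) :=
  ordConnected_of_derivative_closed (f := fun j => f j y)
    (fun j => (hf.derivative_closed j).imp fun _ h => h y) τ

theorem isClosed_relFiber_graph (hf : PolySystem f E) (τ : J → SignType) :
    IsClosed {p : Y × ℝ | p.2 ∈ relFiber f τ p.1} := by
  have : {p : Y × ℝ | p.2 ∈ relFiber f τ p.1} =
      ⋂ j, {p : Y × ℝ | RelSign (τ j) ((f j p.1).eval p.2)} := by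
    ext p; simp [relFiber]
  rw [this]
  exact isClosed_iInter fun j => (isClosed_setOf_relSign (τ j)).preimage (hf.continuous_eval j)

theorem mem_relFiber_of_tendsto (hf : PolySystem f E) {τ : J → SignType} {g : Filter Y} [g.NeBot]
    {y : Y} (hg : g ≤ nhds y) {ξ : Y → ℝ} {u : ℝ} (hξ : Filter.Tendsto ξ g (nhds u))
    (h : ∀ᶠ y' in g, ξ y' ∈ relFiber f τ y') : u ∈ relFiber f τ y := by
  have h1 : Filter.Tendsto (fun y' => (y', ξ y')) g (nhds (y, u)) :=
    (Filter.tendsto_id'.mpr hg).prodMk_nhds hξ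
  exact (hf.isClosed_relFiber_graph τ).mem_of_tendsto h1 h

theorem closure_signFiber_subset (hf : PolySystem f E) (τ : J → SignType) (y : Y) :
    closure (signFiber f τ y) ⊆ relFiber f τ y := by
  have h : IsClosed (relFiber f τ y) :=
    (hf.isClosed_relFiber_graph τ).preimage (Continuous.prodMk_right y)
  exact h.closure_subset_iff.mpr (signFiber_subset_relFiber f τ y)

theorem subsingleton_relFiber (hf : PolySystem f E) {τ : J → SignType} {j : J} (hj : τ j = 0)
    {y : Y} (hy : f j y ≠ 0) : (relFiber f τ y).Subsingleton := by
  have key : ∀ a ∈ relFiber f τ y, ∀ b ∈ relFiber f τ y, ¬ a < b := by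
    intro a ha b hb hab
    refine hy (eq_zero_of_eval_eq_zero_on_Icc hab fun u hu => ?_)
    have := (hf.ordConnected_relFiber τ y).out ha hb hu j
    rwa [hj, relSign_zero_iff] at this
  intro a ha b hb
  rcases lt_trichotomy a b with h | h | h
  · exact absurd h (key a ha b hb)
  · exact h
  · exact absurd h (key b hb a ha)

theorem exists_tendsto_ultrafilter (hf : PolySystem f E) {τ : J → SignType} {j : J} (hj : τ j = 0)
    (hne : ∀ y ∈ E, f j y ≠ 0) {g : Ultrafilter Y} {y : Y} (hy : y ∈ E)
    (hg : (g : Filter Y) ≤ nhdsWithin y E) {ξ : Y → ℝ}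
    (h : ∀ᶠ y' in (g : Filter Y), ξ y' ∈ relFiber f τ y') :
    ∃ u ∈ relFiber f τ y, Filter.Tendsto ξ g (nhds u) := by
  obtain ⟨b, hb, hroot⟩ := hf.root_bound
  have h1 : ∀ᶠ y' in (g : Filter Y), b y' ≤ b y + 1 :=
    hg ((hb y hy).eventually_le_const (lt_add_one _))
  have h2 : ∀ᶠ y' in (g : Filter Y), y' ∈ E := hg self_mem_nhdsWithin
  have h3 : ∀ᶠ y' in (g : Filter Y), ξ y' ∈ Icc (-(b y + 1)) (b y + 1) := by
    filter_upwards [h, h1, h2] with y' ha hb hc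
    have := ha j
    rw [hj, relSign_zero_iff] at this
    exact abs_le.mp ((hroot j y' hc (hne y' hc) _ this).trans hb)
  obtain ⟨u, _, hu⟩ := isCompact_Icc.ultrafilter_le_nhds' (g.map ξ) h3
  exact ⟨u, hf.mem_relFiber_of_tendsto (hg.trans nhdsWithin_le_nhds) hu h, hu⟩

/-- Over the closure of a cell, a point condition is the graph of a continuous function. -/
theorem exists_root_section (hf : PolySystem f E) {τ : J → SignType} {j : J} (hj : τ j = 0)
    (hne : ∀ y ∈ E, f j y ≠ 0) {S : Set Y} (hSE : S ⊆ E)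
    (hS : ∀ y ∈ S, (signFiber f τ y).Nonempty) :
    ∃ ξ : Y → ℝ, ContinuousOn ξ (closure S ∩ E) ∧
      (∀ y ∈ closure S ∩ E, relFiber f τ y = {ξ y}) ∧ ∀ y ∈ S, signFiber f τ y = {ξ y} := by
  have hnon : ∀ y ∈ closure S ∩ E, (relFiber f τ y).Nonempty := by
    rintro y ⟨hyS, hyE⟩
    choose! ξ hξ using hS
    have : (nhdsWithin y S).NeBot := mem_closure_iff_nhdsWithin_neBot.mp hyS
    obtain ⟨u, hu, _⟩ := hf.exists_tendsto_ultrafilter hj hne hyE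
      (g := Ultrafilter.of (nhdsWithin y S)) ((Ultrafilter.of_le _).trans (nhdsWithin_mono y hSE))
      (ξ := ξ) ((Ultrafilter.of_le (nhdsWithin y S)) (by
        filter_upwards [self_mem_nhdsWithin] with y' hy'
        exact signFiber_subset_relFiber f τ y' (hξ y' hy')))
    exact ⟨u, hu⟩
  choose! ξ hξ using hnon
  have hsing : ∀ y ∈ closure S ∩ E, relFiber f τ y = {ξ y} := fun y hy =>
    (hf.subsingleton_relFiber hj (hne y hy.2)).eq_singleton_of_mem (hξ y hy)
  refine ⟨ξ, ?_, hsing, fun y hy => ?_⟩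
  · intro y hy
    rw [ContinuousWithinAt, Filter.tendsto_iff_ultrafilter]
    intro g hg
    obtain ⟨u, hu, hlim⟩ := hf.exists_tendsto_ultrafilter hj hne hy.2
      (hg.trans (nhdsWithin_mono y inter_subset_right)) (ξ := ξ)
      (hg (by filter_upwards [self_mem_nhdsWithin] with y' hy'; exact hξ y' hy'))
    rw [hsing y hy, mem_singleton_iff] at hu
    rwa [← hu]
  · have hyK : y ∈ closure S ∩ E := ⟨subset_closure hy, hSE hy⟩
    refine Subset.antisymm ?_ ?_
    · rw [← hsing y hyK]
      exact signFiber_subset_relFiber f τ y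
    · obtain ⟨v, hv⟩ := hS y hy
      have := signFiber_subset_relFiber f τ y hv
      rw [hsing y hyK, mem_singleton_iff] at this
      rw [← this]
      exact singleton_subset_iff.mpr hv

end PolySystem

/-- Clamping to a band bounded by finitely many continuous functions. -/
theorem exists_clamp {Y α : Type*} [TopologicalSpace Y] {K : Set Y} (L U : Finset α)
    (ξ : α → Y → ℝ) (hL : ∀ a ∈ L, ContinuousOn (ξ a) K) (hU : ∀ a ∈ U, ContinuousOn (ξ a) K)
    (hLU : ∀ a ∈ L, ∀ b ∈ U, ∀ y ∈ K, ξ a y ≤ ξ b y) :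
    ∃ κ : Y × ℝ → ℝ, ContinuousOn κ (K ×ˢ univ) ∧
      (∀ y ∈ K, ∀ u, (∀ a ∈ L, ξ a y ≤ κ (y, u)) ∧ ∀ a ∈ U, κ (y, u) ≤ ξ a y) ∧
      ∀ y ∈ K, ∀ u, (∀ a ∈ L, ξ a y ≤ u) → (∀ a ∈ U, u ≤ ξ a y) → κ (y, u) = u := by
  classical
  have hmapsTo : MapsTo (Prod.fst : Y × ℝ → Y) (K ×ˢ univ) K := fun p hp => hp.1
  have c1 : ContinuousOn (fun p : Y × ℝ => U.fold min p.2 (fun a => ξ a p.1)) (K ×ˢ univ) := by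
    clear hLU
    induction U using Finset.induction_on with
    | empty => simpa using continuous_snd.continuousOn
    | insert a s ha ih =>
      simp only [Finset.fold_insert ha]
      exact ((hU a (Finset.mem_insert_self _ _)).comp continuous_fst.continuousOn hmapsTo).inf'
        (ih fun b hb => hU b (Finset.mem_insert_of_mem hb))
  have c2 : ContinuousOn (fun p : Y × ℝ =>
      L.fold max (U.fold min p.2 (fun a => ξ a p.1)) (fun a => ξ a p.1)) (K ×ˢ univ) := by
    clear hLU
    induction L using Finset.induction_on with
    | empty => simpa using c1
    | insert a s ha ih =>
      simp only [Finset.fold_insert ha]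
      exact ((hL a (Finset.mem_insert_self _ _)).comp continuous_fst.continuousOn hmapsTo).sup'
        (ih fun b hb => hL b (Finset.mem_insert_of_mem hb))
  refine ⟨_, c2, fun y hy u => ⟨fun a ha => ?_, fun a ha => ?_⟩, fun y hy u h1 h2 => ?_⟩
  · exact (Finset.le_fold_max _).mpr (Or.inr ⟨a, ha, le_rfl⟩)
  · refine (Finset.fold_max_le _).mpr ⟨(Finset.fold_min_le _).mpr (Or.inr ⟨a, ha, le_rfl⟩), fun b hb => ?_⟩
    exact hLU b hb a ha y hy
  · have h3 : U.fold min u (fun a => ξ a y) = u :=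
      le_antisymm ((Finset.fold_min_le _).mpr (Or.inl le_rfl)) ((Finset.le_fold_min _).mpr ⟨le_rfl, h2⟩)
    simp only [h3]
    exact le_antisymm ((Finset.fold_max_le _).mpr ⟨le_rfl, h1⟩) ((Finset.le_fold_max _).mpr (Or.inl le_rfl))

theorem monotoneOn_of_relSign_one {p : Polynomial ℝ} {a b : ℝ}
    (h : ∀ u ∈ Icc a b, RelSign 1 (p.derivative.eval u)) :
    MonotoneOn (fun u => p.eval u) (Icc a b) :=
  monotoneOn_of_deriv_nonneg (convex_Icc a b) p.continuousOn p.differentiable.differentiableOn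
    fun u hu => by
      rw [Polynomial.deriv]
      exact relSign_one_iff.mp (h u (interior_subset hu))

theorem antitoneOn_of_relSign_neg_one {p : Polynomial ℝ} {a b : ℝ}
    (h : ∀ u ∈ Icc a b, RelSign (-1) (p.derivative.eval u)) :
    AntitoneOn (fun u => p.eval u) (Icc a b) :=
  antitoneOn_of_deriv_nonpos (convex_Icc a b) p.continuousOn p.differentiable.differentiableOn
    fun u hu => by
      rw [Polynomial.deriv]
      exact relSign_neg_one_iff.mp (h u (interior_subset hu))

theorem eq_zero_of_relSign_of_lt {p : Polynomial ℝ} {s : SignType} (hs : s ≠ 0) {u w : ℝ}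
    (huw : u < w) (hw : p.eval w = 0) (hu : RelSign s (p.eval u))
    (h : ∀ v ∈ Icc u w, RelSign s (p.derivative.eval v)) : p = 0 := by
  refine eq_zero_of_eval_eq_zero_on_Icc huw fun v hv => ?_
  have hul := left_mem_Icc.mpr huw.le
  have hwr := right_mem_Icc.mpr huw.le
  cases s
  · exact absurd rfl hs
  · have hm := antitoneOn_of_relSign_neg_one h
    have h1 := hm hul hv hv.1
    have h2 := hm hv hwr hv.2
    have h3 := relSign_neg_one_iff.mp hu
    simp only at h1 h2
    linarith
  · have hm := monotoneOn_of_relSign_one h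
    have h1 := hm hul hv hv.1
    have h2 := hm hv hwr hv.2
    have h3 := relSign_one_iff.mp hu
    simp only at h1 h2
    linarith

theorem eq_zero_of_relSign_of_gt {p : Polynomial ℝ} {s : SignType} (hs : s ≠ 0) {u w : ℝ}
    (huw : w < u) (hw : p.eval w = 0) (hu : RelSign s (p.eval u))
    (h : ∀ v ∈ Icc w u, RelSign (-s) (p.derivative.eval v)) : p = 0 := by
  refine eq_zero_of_eval_eq_zero_on_Icc huw fun v hv => ?_
  have hul := left_mem_Icc.mpr huw.le
  have hwr := right_mem_Icc.mpr huw.le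
  cases s
  · exact absurd rfl hs
  · have hm := monotoneOn_of_relSign_one h
    have h1 := hm hul hv hv.1
    have h2 := hm hv hwr hv.2
    have h3 := relSign_neg_one_iff.mp hu
    simp only at h1 h2
    linarith
  · have hm := antitoneOn_of_relSign_neg_one h
    have h1 := hm hul hv hv.1
    have h2 := hm hv hwr hv.2
    have h3 := relSign_one_iff.mp hu
    simp only at h1 h2
    linarith

theorem sign_eval_eq_of_root_lt {p : Polynomial ℝ} {a u : ℝ} (hau : a < u) (ha : p.eval a = 0)
    (h : ∀ v ∈ Ioc a u, p.derivative.eval v ≠ 0) :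
    SignType.sign (p.eval u) = SignType.sign (p.derivative.eval u) := by
  obtain ⟨c, hc, hc'⟩ := exists_deriv_eq_slope (fun v => p.eval v) hau p.continuousOn
    p.differentiable.differentiableOn
  rw [Polynomial.deriv, ha, sub_zero, eq_div_iff (sub_pos.mpr hau).ne'] at hc'
  rw [← hc', sign_mul, sign_pos (sub_pos.mpr hau), mul_one]
  exact sign_eval_eq_of_forall_ne_zero ordConnected_Ioc h ⟨hc.1, hc.2.le⟩ ⟨hau, le_rfl⟩

theorem sign_eval_eq_of_lt_root {p : Polynomial ℝ} {a u : ℝ} (hau : u < a) (ha : p.eval a = 0)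
    (h : ∀ v ∈ Ico u a, p.derivative.eval v ≠ 0) :
    SignType.sign (p.derivative.eval u) = - SignType.sign (p.eval u) := by
  obtain ⟨c, hc, hc'⟩ := exists_deriv_eq_slope (fun v => p.eval v) hau p.continuousOn
    p.differentiable.differentiableOn
  rw [Polynomial.deriv, ha, zero_sub, eq_div_iff (sub_pos.mpr hau).ne'] at hc'
  rw [← Left.sign_neg, ← hc', sign_mul, sign_pos (sub_pos.mpr hau), mul_one]
  exact sign_eval_eq_of_forall_ne_zero ordConnected_Ico h ⟨le_rfl, hau⟩ ⟨hc.1.le, hc.2⟩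

namespace PolySystem

variable {Y J : Type*} [TopologicalSpace Y] {f : J → Y → Polynomial ℝ} {E : Set Y}

/-- Over the closure of a cell, the relaxed fibres of a realized sign condition form a continuous
family of intervals, and the retractions onto them depend continuously on the parameter. -/
theorem exists_fibre_retraction [Finite J] (hf : PolySystem f E) {S : Set Y} (hSE : S ⊆ E)
    (hθ : ∀ y ∈ S, ∀ y' ∈ S, ∃ θ : ℝ ≃o ℝ, ∀ j u,
      SignType.sign ((f j y).eval u) = SignType.sign ((f j y').eval (θ u)))
    {τ : J → SignType} {y₀ : Y} (hy₀ : y₀ ∈ S) {u₀ : ℝ} (hu₀ : u₀ ∈ signFiber f τ y₀) :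
    ∃ κ : Y × ℝ → ℝ, ContinuousOn κ ((closure S ∩ E) ×ˢ univ) ∧
      (∀ y ∈ closure S ∩ E, ∀ u, κ (y, u) ∈ relFiber f τ y) ∧
      (∀ y ∈ closure S ∩ E, ∀ u ∈ relFiber f τ y, κ (y, u) = u) ∧
      ∀ y ∈ S, relFiber f τ y ⊆ closure (signFiber f τ y) := by
  classical
  have hSK : S ⊆ closure S ∩ E := fun y hy => ⟨subset_closure hy, hSE hy⟩
  choose! θ hθ using fun y hy => hθ y₀ hy₀ y hy
  have hdich : ∀ j, f j y₀ ≠ 0 → ∀ y ∈ E, f j y ≠ 0 := fun j hj =>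
    (hf.zero_or_ne_zero j).resolve_left fun h => hj (h y₀ (hSE hy₀))
  have hsec : ∀ a : ℝ, (∃ j, f j y₀ ≠ 0 ∧ (f j y₀).eval a = 0) →
      ∃ ξ : Y → ℝ, ContinuousOn ξ (closure S ∩ E) ∧
        (∀ y ∈ closure S ∩ E,
          relFiber f (fun j => SignType.sign ((f j y₀).eval a)) y = {ξ y}) ∧
        ∀ y ∈ S, signFiber f (fun j => SignType.sign ((f j y₀).eval a)) y = {ξ y} := by
    rintro a ⟨j, hj, hja⟩
    refine hf.exists_root_section (j := j) (by simp [hja]) (hdich j hj) hSE fun y hy => ?_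
    exact ⟨θ y a, fun i => (hθ y hy i a).symm⟩
  by_cases hex : ∃ j, f j y₀ ≠ 0 ∧ (f j y₀).eval u₀ = 0
  · obtain ⟨ξ, hξc, hξr, hξs⟩ := hsec u₀ hex
    have hτ : (fun j => SignType.sign ((f j y₀).eval u₀)) = τ := funext hu₀
    rw [hτ] at hξr hξs
    refine ⟨fun p => ξ p.1, hξc.comp continuous_fst.continuousOn fun p hp => hp.1, ?_, ?_, ?_⟩
    · intro y hy u
      rw [hξr y hy]; rfl
    · intro y hy u hu
      rw [hξr y hy] at hu
      exact hu.symm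
    · intro y hy
      rw [hξr y (hSK hy), hξs y hy]
      exact subset_closure
  have hfin : {a : ℝ | ∃ j, f j y₀ ≠ 0 ∧ (f j y₀).eval a = 0}.Finite := by
    have : {a : ℝ | ∃ j, f j y₀ ≠ 0 ∧ (f j y₀).eval a = 0} =
        ⋃ j, {a : ℝ | f j y₀ ≠ 0 ∧ (f j y₀).eval a = 0} := by ext a; simp
    rw [this]
    refine Set.finite_iUnion fun j => ?_
    by_cases hj : f j y₀ = 0
    · simp [hj]
    · exact ((f j y₀).finite_setOfPred_isRoot hj).subset fun a ha => ha.2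
  choose! ξ hξc hξr hξs using hsec
  set A₀ := hfin.toFinset with hA₀
  have hmem : ∀ {a}, a ∈ A₀ ↔ ∃ j, f j y₀ ≠ 0 ∧ (f j y₀).eval a = 0 := by
    intro a; simp [hA₀]
  have hξθ : ∀ a ∈ A₀, ∀ y ∈ S, ξ a y = θ y a := by
    intro a ha y hy
    have : θ y a ∈ signFiber f (fun j => SignType.sign ((f j y₀).eval a)) y :=
      fun i => (hθ y hy i a).symm
    rw [hξs a (hmem.mp ha) y hy] at this
    exact this.symm
  have hξroot : ∀ a ∈ A₀, ∀ y ∈ closure S ∩ E, ∀ j, (f j y₀).eval a = 0 →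
      (f j y).eval (ξ a y) = 0 := by
    intro a ha y hy j hj
    have : ξ a y ∈ relFiber f (fun j => SignType.sign ((f j y₀).eval a)) y := by
      rw [hξr a (hmem.mp ha) y hy]; rfl
    have := this j
    simp only at this
    rwa [hj, sign_zero, relSign_zero_iff] at this
  have hmono : ∀ a ∈ A₀, ∀ b ∈ A₀, a ≤ b → ∀ y ∈ closure S ∩ E, ξ a y ≤ ξ b y := by
    intro a ha b hb hab y hy
    refine ContinuousWithinAt.closure_le hy.1 ((hξc a (hmem.mp ha) y hy).mono hSK)
      ((hξc b (hmem.mp hb) y hy).mono hSK) fun z hz => ?_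
    rw [hξθ a ha z hz, hξθ b hb z hz]
    exact (θ z).monotone hab
  set L := A₀.filter (· < u₀) with hL
  set U := A₀.filter (u₀ < ·) with hU
  have hLA : ∀ a ∈ L, a ∈ A₀ ∧ a < u₀ := fun a ha => Finset.mem_filter.mp ha
  have hUA : ∀ a ∈ U, a ∈ A₀ ∧ u₀ < a := fun a ha => Finset.mem_filter.mp ha
  have hu₀A : u₀ ∉ A₀ := fun h => hex (hmem.mp h)
  have hLU : ∀ a ∈ A₀, a ∈ L ∨ a ∈ U := by
    intro a ha
    rcases lt_trichotomy a u₀ with h | h | h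
    · exact Or.inl (Finset.mem_filter.mpr ⟨ha, h⟩)
    · exact absurd (h ▸ ha) hu₀A
    · exact Or.inr (Finset.mem_filter.mpr ⟨ha, h⟩)
  obtain ⟨κ, hκc, hκband, hκid⟩ := exists_clamp (K := closure S ∩ E) L U ξ
    (fun a ha => hξc a (hmem.mp (hLA a ha).1)) (fun a ha => hξc a (hmem.mp (hUA a ha).1))
    (fun a ha b hb => hmono a (hLA a ha).1 b (hUA b hb).1 ((hLA a ha).2.trans (hUA b hb).2).le)
  have hopen : ∀ y ∈ S, ∀ u, (∀ a ∈ L, ξ a y < u) → (∀ a ∈ U, u < ξ a y) →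
      u ∈ signFiber f τ y := by
    intro y hy u h1 h2 j
    obtain ⟨w, rfl⟩ := (θ y).surjective u
    rw [← hθ y hy j w, ← hu₀ j]
    by_cases hj : f j y₀ = 0
    · simp [hj]
    refine sign_eval_eq_of_forall_ne_zero ordConnected_uIcc (s := uIcc w u₀) (fun a ha h0 => ?_)
      left_mem_uIcc right_mem_uIcc
    have haA : a ∈ A₀ := hmem.mpr ⟨j, hj, h0⟩
    rcases hLU a haA with hl | hu
    · have h3 := h1 a hl
      rw [hξθ a haA y hy, (θ y).lt_iff_lt] at h3
      have h4 := (hLA a hl).2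
      rcases mem_uIcc.mp ha with h5 | h5 <;> linarith [h5.1, h5.2]
    · have h3 := h2 a hu
      rw [hξθ a haA y hy, (θ y).lt_iff_lt] at h3
      have h4 := (hUA a hu).2
      rcases mem_uIcc.mp ha with h5 | h5 <;> linarith [h5.1, h5.2]
  have hband : ∀ y ∈ S, ∀ u, (∀ a ∈ L, ξ a y ≤ u) → (∀ a ∈ U, u ≤ ξ a y) →
      u ∈ closure (signFiber f τ y) := by
    intro y hy u h1 h2
    have h3 : ∀ a ∈ L, ξ a y < θ y u₀ := fun a ha => by
      rw [hξθ a (hLA a ha).1 y hy, (θ y).lt_iff_lt]; exact (hLA a ha).2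
    have h4 : ∀ a ∈ U, θ y u₀ < ξ a y := fun a ha => by
      rw [hξθ a (hUA a ha).1 y hy, (θ y).lt_iff_lt]; exact (hUA a ha).2
    rcases lt_trichotomy u (θ y u₀) with h | h | h
    · have hsub : Ioo u (θ y u₀) ⊆ signFiber f τ y := fun v hv =>
        hopen y hy v (fun a ha => (h1 a ha).trans_lt hv.1) fun a ha => hv.2.trans (h4 a ha)
      refine closure_mono hsub ?_
      rw [closure_Ioo h.ne]
      exact left_mem_Icc.mpr h.le
    · rw [h]
      exact subset_closure (hopen y hy _ h3 h4)
    · have hsub : Ioo (θ y u₀) u ⊆ signFiber f τ y := fun v hv =>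
        hopen y hy v (fun a ha => (h3 a ha).trans hv.1) fun a ha => hv.2.trans_le (h2 a ha)
      refine closure_mono hsub ?_
      rw [closure_Ioo h.ne]
      exact right_mem_Icc.mpr h.le
  have hκrel : ∀ y ∈ closure S ∩ E, ∀ u, κ (y, u) ∈ relFiber f τ y := by
    intro y hy u
    have : (nhdsWithin y S).NeBot := mem_closure_iff_nhdsWithin_neBot.mp hy.1
    have hcont : ContinuousWithinAt (fun z => κ (z, u)) S y := by
      refine (hκc (y, u) ⟨hy, mem_univ _⟩).comp (t := (closure S ∩ E) ×ˢ univ) (f := fun z => (z, u))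
        (by fun_prop) fun z hz => ⟨hSK hz, mem_univ _⟩
    refine hf.mem_relFiber_of_tendsto nhdsWithin_le_nhds hcont ?_
    filter_upwards [self_mem_nhdsWithin] with z hz
    exact hf.closure_signFiber_subset τ z
      (hband z hz _ (hκband z (hSK hz) u).1 (hκband z (hSK hz) u).2)
  have hroot_deriv : ∀ {a}, a ∈ A₀ → ∃ j j', f j y₀ ≠ 0 ∧ (f j y₀).eval a = 0 ∧ τ j ≠ 0 ∧
      (∀ y, f j' y = (f j y).derivative) ∧
      ∀ v, (f j y₀).derivative.eval v = 0 → v ∈ A₀ := by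
    intro a ha
    obtain ⟨j, hj, hja⟩ := hmem.mp ha
    obtain ⟨j', hj'⟩ := hf.derivative_closed j
    have hju : (f j y₀).eval u₀ ≠ 0 := fun h => hex ⟨j, hj, h⟩
    refine ⟨j, j', hj, hja, ?_, hj', fun v hv => hmem.mpr ⟨j', ?_, by rw [hj', hv]⟩⟩
    · rw [← hu₀ j]
      exact sign_ne_zero.mpr hju
    · rw [hj']
      intro h0
      have hc := Polynomial.derivative_eq_zero.mp h0
      rw [Polynomial.eq_C_of_natDegree_eq_zero hc, Polynomial.eval_C] at hja hju
      exact hju hja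
  have hrelband : ∀ y ∈ closure S ∩ E, ∀ u ∈ relFiber f τ y,
      (∀ a ∈ L, ξ a y ≤ u) ∧ ∀ a ∈ U, u ≤ ξ a y := by
    intro y hy u hu
    constructor
    · intro a ha
      by_contra! hlt
      obtain ⟨q, hqL, hqmax⟩ := L.exists_max_image id ⟨a, ha⟩
      have hq := hLA q hqL
      replace hlt : u < ξ q y := hlt.trans_le (hmono a (hLA a ha).1 q hq.1 (hqmax a ha) y hy)
      have hqrel : ξ q y ∈ relFiber f τ y := by
        rw [← hκid y hy (ξ q y) (fun b hb => hmono b (hLA b hb).1 q hq.1 (hqmax b hb) y hy)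
          fun b hb => hmono q hq.1 b (hUA b hb).1 (hq.2.trans (hUA b hb).2).le y hy]
        exact hκrel y hy _
      obtain ⟨j, j', hj, hjq, hτj, hj', hroots⟩ := hroot_deriv hq.1
      have hτ : τ j' = τ j := by
        rw [← hu₀ j, ← hu₀ j', hj']
        refine (sign_eval_eq_of_root_lt hq.2 hjq fun v hv h0 => ?_).symm
        have hvA := hroots v h0
        rcases hLU v hvA with h | h
        · exact absurd (hqmax v h) (not_le.mpr hv.1)
        · exact absurd hv.2 (not_le.mpr (hUA v h).2)
      refine hdich j hj y hy.2 (eq_zero_of_relSign_of_lt hτj hlt (hξroot q hq.1 y hy j hjq)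
        (hu j) fun v hv => ?_)
      have := (hf.ordConnected_relFiber τ y).out hu hqrel hv j'
      rwa [hτ, hj'] at this
    · intro a ha
      by_contra! hlt
      obtain ⟨q, hqU, hqmin⟩ := U.exists_min_image id ⟨a, ha⟩
      have hq := hUA q hqU
      replace hlt : ξ q y < u := (hmono q hq.1 a (hUA a ha).1 (hqmin a ha) y hy).trans_lt hlt
      have hqrel : ξ q y ∈ relFiber f τ y := by
        rw [← hκid y hy (ξ q y)
          (fun b hb => hmono b (hLA b hb).1 q hq.1 ((hLA b hb).2.trans hq.2).le y hy)
          fun b hb => hmono q hq.1 b (hUA b hb).1 (hqmin b hb) y hy]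
        exact hκrel y hy _
      obtain ⟨j, j', hj, hjq, hτj, hj', hroots⟩ := hroot_deriv hq.1
      have hτ : τ j' = - τ j := by
        rw [← hu₀ j, ← hu₀ j', hj']
        refine sign_eval_eq_of_lt_root hq.2 hjq fun v hv h0 => ?_
        have hvA := hroots v h0
        rcases hLU v hvA with h | h
        · exact absurd hv.1 (not_le.mpr (hLA v h).2)
        · exact absurd (hqmin v h) (not_le.mpr hv.2)
      refine hdich j hj y hy.2 (eq_zero_of_relSign_of_gt hτj hlt (hξroot q hq.1 y hy j hjq)
        (hu j) fun v hv => ?_)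
      have := (hf.ordConnected_relFiber τ y).out hqrel hu hv j'
      rwa [hτ, hj'] at this
  refine ⟨κ, hκc, hκrel, fun y hy u hu => ?_, fun y hy u hu => ?_⟩
  · exact hκid y hy u (hrelband y hy u hu).1 (hrelband y hy u hu).2
  · exact hband y hy u (hrelband y (hSK hy) u hu).1 (hrelband y (hSK hy) u hu).2

end PolySystem

/-- A finite decomposition into cells satisfying the frontier condition, such that the set retracts
onto the closure of each cell, compatibly with the parameter `π`. -/
structure CellDecomposition {Z ι : Type*} [TopologicalSpace Z] (π : Z → ℝ) (E : Set Z)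
    (S : ι → Set Z) : Prop where
  subset : ∀ i, S i ⊆ E
  cover : ∀ z ∈ E, ∃ i, z ∈ S i
  frontier : ∀ i j, (S j ∩ closure (S i)).Nonempty → S j ⊆ closure (S i)
  retraction : ∀ i, ∃ r : Z → Z, ContinuousOn r E ∧ (∀ z ∈ E, r z ∈ closure (S i) ∩ E) ∧
    (∀ z ∈ E, π (r z) = π z) ∧ ∀ z ∈ closure (S i) ∩ E, r z = z

theorem CellDecomposition.preimage {Z Z' ι : Type*} [TopologicalSpace Z] [TopologicalSpace Z']
    {π : Z → ℝ} {E : Set Z} {S : ι → Set Z} (h : CellDecomposition π E S) (Φ : Z' ≃ₜ Z) :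
    CellDecomposition (fun z => π (Φ z)) (Φ ⁻¹' E) (fun i => Φ ⁻¹' (S i)) where
  subset i := preimage_mono (h.subset i)
  cover z hz := h.cover (Φ z) hz
  frontier i j := by
    rw [← Φ.preimage_closure]
    rintro ⟨z, hz1, hz2⟩
    exact preimage_mono (h.frontier i j ⟨Φ z, hz1, hz2⟩)
  retraction i := by
    obtain ⟨r, hr, h1, h2, h3⟩ := h.retraction i
    rw [← Φ.preimage_closure]
    refine ⟨fun z => Φ.symm (r (Φ z)), ?_, fun z hz => ?_, fun z hz => ?_, fun z hz => ?_⟩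
    · exact Φ.symm.continuous.comp_continuousOn
        (hr.comp Φ.continuous.continuousOn fun z hz => hz)
    · have := h1 (Φ z) hz
      simpa using this
    · simpa using h2 (Φ z) hz
    · exact (congrArg Φ.symm (h3 (Φ z) hz)).trans (Φ.symm_apply_apply z)

/-- The cell over `S` given by the sign condition `τ`. -/
def liftCell {Y J : Type*} (f : J → Y → Polynomial ℝ) (S : Set Y) (τ : J → SignType) :
    Set (Y × ℝ) :=
  {p | p.1 ∈ S ∧ p.2 ∈ signFiber f τ p.1}

theorem closure_liftCell_inter {Y J : Type*} [TopologicalSpace Y] {f : J → Y → Polynomial ℝ}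
    {E : Set Y} [Finite J] (hf : PolySystem f E) {S : Set Y} (hSE : S ⊆ E)
    (hθ : ∀ y ∈ S, ∀ y' ∈ S, ∃ θ : ℝ ≃o ℝ, ∀ j u,
      SignType.sign ((f j y).eval u) = SignType.sign ((f j y').eval (θ u)))
    {τ : J → SignType} (hne : (liftCell f S τ).Nonempty) :
    closure (liftCell f S τ) ∩ Prod.fst ⁻¹' E =
      {p | p.1 ∈ closure S ∩ E ∧ p.2 ∈ relFiber f τ p.1} := by
  obtain ⟨⟨y₀, u₀⟩, hy₀, hu₀⟩ := hne
  obtain ⟨κ, hκ, hκ1, hκ2, hκ3⟩ := hf.exists_fibre_retraction hSE hθ hy₀ hu₀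
  have hSK : S ⊆ closure S ∩ E := fun y hy => ⟨subset_closure hy, hSE hy⟩
  ext ⟨y, u⟩
  constructor
  · rintro ⟨h1, h2⟩
    refine ⟨⟨?_, h2⟩, ?_⟩
    · exact map_mem_closure continuous_fst h1 fun p hp => hp.1
    · have hsub : liftCell f S τ ⊆ {p : Y × ℝ | p.2 ∈ relFiber f τ p.1} := fun p hp =>
        signFiber_subset_relFiber f τ _ hp.2
      exact (hf.isClosed_relFiber_graph τ).closure_subset_iff.mpr hsub h1
  · rintro ⟨hy, hu⟩
    refine ⟨?_, hy.2⟩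
    have hsub : ∀ z ∈ S, (z, κ (z, u)) ∈ closure (liftCell f S τ) := by
      intro z hz
      exact map_mem_closure (f := fun v => (z, v)) (by fun_prop)
        (hκ3 z hz (hκ1 z (hSK hz) u)) fun v hv => ⟨hz, hv⟩
    have hcont : ContinuousWithinAt (fun z => (z, κ (z, u))) S y := by
      refine continuousWithinAt_id.prodMk ?_
      exact (hκ (y, u) ⟨hy, mem_univ _⟩).comp (t := (closure S ∩ E) ×ˢ univ)
        (f := fun z => (z, u)) (by fun_prop) fun z hz => ⟨hSK hz, mem_univ _⟩
    have := hcont.mem_closure hy.1 hsub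
    rwa [hκ2 y hy u hu, closure_closure] at this

theorem CellDecomposition.lift {Y J ι : Type*} [TopologicalSpace Y] {f : J → Y → Polynomial ℝ}
    {E : Set Y} [Finite J] (hf : PolySystem f E) {π : Y → ℝ} {S : ι → Set Y}
    (h : CellDecomposition π E S)
    (hθ : ∀ i, ∀ y ∈ S i, ∀ y' ∈ S i, ∃ θ : ℝ ≃o ℝ, ∀ j u,
      SignType.sign ((f j y).eval u) = SignType.sign ((f j y').eval (θ u))) :
    CellDecomposition (fun p : Y × ℝ => π p.1) (Prod.fst ⁻¹' E)
      (fun i : {x : ι × (J → SignType) // (liftCell f (S x.1) x.2).Nonempty} =>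
        liftCell f (S i.1.1) i.1.2) where
  subset i := fun p hp => h.subset _ hp.1
  cover := by
    rintro ⟨y, u⟩ hp
    obtain ⟨i, hi⟩ := h.cover y hp
    exact ⟨⟨(i, fun j => SignType.sign ((f j y).eval u)), ⟨(y, u), hi, fun _ => rfl⟩⟩,
      hi, fun _ => rfl⟩
  frontier := by
    rintro ⟨⟨i, τ⟩, hne⟩ ⟨⟨i', τ'⟩, hne'⟩ ⟨⟨y, u⟩, ⟨hy, hu⟩, h2⟩ ⟨y', u'⟩ ⟨hy', hu'⟩
    have heq := closure_liftCell_inter hf (h.subset i) (hθ i) hne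
    have h3 : (y, u) ∈ closure (liftCell f (S i) τ) ∩ Prod.fst ⁻¹' E := ⟨h2, h.subset i' hy⟩
    rw [heq] at h3
    have h4 : (y', u') ∈ closure (liftCell f (S i) τ) ∩ Prod.fst ⁻¹' E := by
      rw [heq]
      refine ⟨⟨h.frontier i i' ⟨y, hy, h3.1.1⟩ hy', h.subset i' hy'⟩, fun j => ?_⟩
      have := h3.2 j
      rw [RelSign] at this ⊢
      rw [hu j] at this
      rw [hu' j]
      exact this
    exact h4.1
  retraction := by
    rintro ⟨⟨i, τ⟩, hne⟩
    have heq := closure_liftCell_inter hf (h.subset i) (hθ i) hne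
    obtain ⟨⟨y₀, u₀⟩, hy₀, hu₀⟩ := hne
    obtain ⟨κ, hκ, hκ1, hκ2, hκ3⟩ := hf.exists_fibre_retraction (h.subset i) (hθ i) hy₀ hu₀
    obtain ⟨r, hr, hr1, hr2, hr3⟩ := h.retraction i
    have hrc : ContinuousOn (fun p : Y × ℝ => r p.1) (Prod.fst ⁻¹' E) :=
      hr.comp continuous_fst.continuousOn fun p hp => hp
    refine ⟨fun p => (r p.1, κ (r p.1, p.2)), ?_, ?_, fun p hp => hr2 p.1 hp, ?_⟩
    · refine hrc.prodMk (hκ.comp (hrc.prodMk continuous_snd.continuousOn) fun p hp => ?_)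
      exact ⟨hr1 p.1 hp, mem_univ _⟩
    · intro p hp
      simp only at heq ⊢
      rw [heq]
      exact ⟨hr1 p.1 hp, hκ1 _ (hr1 p.1 hp) _⟩
    · intro p hp
      simp only at hp ⊢
      rw [heq] at hp
      rw [hr3 p.1 hp.1, hκ2 p.1 hp.1 _ hp.2]

/-- Evaluation at the point `(x, t)` of a polynomial with coefficients in `ℝ[T]`. -/
noncomputable def evalPoint {k : ℕ} (p : (Fin k → ℝ) × ℝ) :
    MvPolynomial (Fin k) (Polynomial ℝ) →+* ℝ :=
  eval₂Hom (Polynomial.evalRingHom p.2) p.1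

theorem continuous_evalPoint {k : ℕ} (P : MvPolynomial (Fin k) (Polynomial ℝ)) :
    Continuous fun p : (Fin k → ℝ) × ℝ => evalPoint p P := by
  induction P using MvPolynomial.induction_on with
  | C a =>
    simp only [evalPoint, coe_eval₂Hom, eval₂_C, Polynomial.coe_evalRingHom]
    exact a.continuous.comp continuous_snd
  | add P Q hP hQ =>
    simp only [map_add]
    exact hP.add hQ
  | mul_X P i hP =>
    simp only [map_mul]
    refine hP.mul ?_
    simp only [evalPoint, coe_eval₂Hom, eval₂_X]
    fun_prop

theorem evalPoint_C {k : ℕ} (p : (Fin k → ℝ) × ℝ) (c : Polynomial ℝ) :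
    evalPoint p (C c) = c.eval p.2 := by simp [evalPoint]

theorem evalPoint_shear {k N : ℕ} (x : Fin (k + 1) → ℝ) (t : ℝ)
    (P : MvPolynomial (Fin (k + 1)) (Polynomial ℝ)) :
    evalPoint (shearHomeomorph k N x, t) P =
      ((finSuccEquiv _ k (shearHom _ k N P)).map (evalPoint (Fin.tail x, t))).eval (x 0) := by
  rw [evalPoint, ← eval₂_shearHom]
  generalize shearHom (Polynomial ℝ) k N P = Q
  simp only [evalPoint, coe_eval₂Hom]
  induction Q using MvPolynomial.induction_on with
  | C a => simp [finSuccEquiv_apply]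
  | add P Q hP hQ => simp [hP, hQ]
  | mul_X P i hP =>
    rw [eval₂_mul, hP, map_mul, Polynomial.map_mul, Polynomial.eval_mul]
    congr 1
    cases i using Fin.cases with
    | zero => simp [finSuccEquiv_X_zero]
    | succ i => simp [finSuccEquiv_X_succ, Fin.tail]

/-- Each polynomial is zero or has a nonzero leading coefficient depending on `t` only. -/
def HasParameterLeadingCoeff {k : ℕ} (f : Polynomial (MvPolynomial (Fin k) (Polynomial ℝ))) :
    Prop :=
  f = 0 ∨ ∃ c : Polynomial ℝ, c ≠ 0 ∧ f.leadingCoeff = C c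

theorem HasParameterLeadingCoeff.derivative {k : ℕ}
    {f : Polynomial (MvPolynomial (Fin k) (Polynomial ℝ))} (hf : HasParameterLeadingCoeff f) :
    HasParameterLeadingCoeff f.derivative := by
  rcases hf with rfl | ⟨c, hc, h⟩
  · left; simp
  · by_cases h0 : f.natDegree = 0
    · left; exact Polynomial.derivative_of_natDegree_zero h0
    · right
      refine ⟨c * (f.natDegree : Polynomial ℝ), mul_ne_zero hc (by exact_mod_cast h0), ?_⟩
      rw [Polynomial.leadingCoeff_derivative, h, C_mul]
      simp

theorem exists_derivative_closed {k : ℕ}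
    (F : Finset (Polynomial (MvPolynomial (Fin k) (Polynomial ℝ))))
    (hF : ∀ f ∈ F, HasParameterLeadingCoeff f) :
    ∃ F' : Finset (Polynomial (MvPolynomial (Fin k) (Polynomial ℝ))), F ⊆ F' ∧
      (∀ f ∈ F', HasParameterLeadingCoeff f) ∧ ∀ f ∈ F', f.derivative ∈ F' := by
  classical
  refine ⟨F.biUnion fun f => (Finset.range (f.natDegree + 2)).image
    fun i => Polynomial.derivative^[i] f, fun f hf => ?_, fun f hf => ?_, fun f hf => ?_⟩
  · simp only [Finset.mem_biUnion, Finset.mem_image, Finset.mem_range]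
    exact ⟨f, hf, 0, by omega, rfl⟩
  · simp only [Finset.mem_biUnion, Finset.mem_image, Finset.mem_range] at hf
    obtain ⟨g, hg, i, _, rfl⟩ := hf
    clear * - hg hF
    induction i with
    | zero => exact hF g hg
    | succ i ih =>
      rw [Function.iterate_succ_apply']
      exact ih.derivative
  · simp only [Finset.mem_biUnion, Finset.mem_image, Finset.mem_range] at hf ⊢
    obtain ⟨g, hg, i, hi, rfl⟩ := hf
    rcases Nat.lt_or_ge i (g.natDegree + 1) with h | h
    · exact ⟨g, hg, i + 1, by omega, Function.iterate_succ_apply' _ _ _⟩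
    · refine ⟨g, hg, i, by omega, ?_⟩
      rw [Polynomial.iterate_derivative_eq_zero (by omega)]
      simp

/-- Real roots are bounded by `1` plus the sum of the coefficients over the leading one. -/
theorem abs_le_of_eval_eq_zero {p : Polynomial ℝ} {n : ℕ} (hn : p.natDegree = n) (hp : p ≠ 0)
    {u : ℝ} (hu : p.eval u = 0) :
    |u| ≤ 1 + (∑ i ∈ Finset.range n, |p.coeff i|) / |p.coeff n| := by
  have hlc : 0 < |p.coeff n| := by
    rw [abs_pos, ← hn]
    exact Polynomial.leadingCoeff_ne_zero.mpr hp
  have hS : 0 ≤ ∑ i ∈ Finset.range n, |p.coeff i| := Finset.sum_nonneg fun i _ => abs_nonneg _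
  by_contra! hlt
  have h1 : 1 < |u| := lt_of_le_of_lt (le_add_of_nonneg_right (by positivity)) hlt
  have h2 : (∑ i ∈ Finset.range n, |p.coeff i|) < |u| * |p.coeff n| := by
    rw [← div_lt_iff₀ hlc]
    linarith
  rw [Polynomial.eval_eq_sum_range, hn, Finset.sum_range_succ] at hu
  have h3 : |p.coeff n| * |u| ^ n ≤ ∑ i ∈ Finset.range n, |p.coeff i| * |u| ^ i := by
    rw [← abs_pow, ← abs_mul, eq_neg_of_add_eq_zero_right hu, abs_neg]
    refine (Finset.abs_sum_le_sum_abs _ _).trans (Finset.sum_le_sum fun i _ => ?_)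
    rw [abs_mul, abs_pow]
  rcases n with _ | n
  · simp at h3 hlc
    exact absurd h3 hlc
  have h4 : ∑ i ∈ Finset.range (n + 1), |p.coeff i| * |u| ^ i ≤
      (∑ i ∈ Finset.range (n + 1), |p.coeff i|) * |u| ^ n := by
    rw [Finset.sum_mul]
    refine Finset.sum_le_sum fun i hi => mul_le_mul_of_nonneg_left ?_ (abs_nonneg _)
    exact pow_le_pow_right₀ h1.le (by simp at hi; omega)
  have h5 : (∑ i ∈ Finset.range (n + 1), |p.coeff i|) * |u| ^ n <
      |u| * |p.coeff (n + 1)| * |u| ^ n := mul_lt_mul_of_pos_right h2 (by positivity)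
  have h6 : |u| * |p.coeff (n + 1)| * |u| ^ n = |p.coeff (n + 1)| * |u| ^ (n + 1) := by ring
  linarith

/-- The part of the space where the parameter lies in `(0, t₁)`. -/
def slab (k : ℕ) (t₁ : ℝ) : Set ((Fin k → ℝ) × ℝ) := {p | p.2 ∈ Ioo 0 t₁}

theorem continuous_eval_map_evalPoint {k : ℕ}
    (f : Polynomial (MvPolynomial (Fin k) (Polynomial ℝ))) :
    Continuous fun q : ((Fin k → ℝ) × ℝ) × ℝ => (f.map (evalPoint q.1)).eval q.2 := by
  simp only [Polynomial.eval_map, Polynomial.eval₂_eq_sum_range]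
  exact continuous_finsetSum _ fun i _ =>
    ((continuous_evalPoint _).comp continuous_fst).mul (continuous_snd.pow i)

theorem polySystem_of_leadingCoeff_ne_zero {k : ℕ}
    {F : Finset (Polynomial (MvPolynomial (Fin k) (Polynomial ℝ)))}
    (hD : ∀ f ∈ F, f.derivative ∈ F) {t₁ : ℝ}
    (ht₁ : ∀ f ∈ F, f ≠ 0 → ∀ y ∈ slab k t₁, evalPoint y f.leadingCoeff ≠ 0) :
    PolySystem (fun (j : F) y => j.1.map (evalPoint y)) (slab k t₁) where
  continuous_eval j := continuous_eval_map_evalPoint j.1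
  zero_or_ne_zero := by
    rintro ⟨f, hf⟩
    by_cases h0 : f = 0
    · left; intro y _; simp [h0]
    · right
      intro y hy h
      apply ht₁ f hf h0 y hy
      rw [Polynomial.leadingCoeff, ← Polynomial.coeff_map]
      simp only at h
      rw [h, Polynomial.coeff_zero]
  derivative_closed := by
    rintro ⟨f, hf⟩
    exact ⟨⟨f.derivative, hD f hf⟩, fun y => (Polynomial.derivative_map f _).symm⟩
  root_bound := by
    classical
    have hb : ∀ f ∈ F, ∃ b : (Fin k → ℝ) × ℝ → ℝ, ContinuousOn b (slab k t₁) ∧ (∀ y, 0 ≤ b y) ∧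
        ∀ y ∈ slab k t₁, f.map (evalPoint y) ≠ 0 → ∀ u, (f.map (evalPoint y)).eval u = 0 →
          |u| ≤ b y := by
      intro f hf
      by_cases h0 : f = 0
      · exact ⟨0, continuousOn_const, fun _ => le_rfl, fun y _ h => absurd (by simp [h0]) h⟩
      refine ⟨fun y => 1 + (∑ i ∈ Finset.range f.natDegree, |evalPoint y (f.coeff i)|) /
        |evalPoint y f.leadingCoeff|, ?_, fun y => by positivity, fun y hy hne u hu => ?_⟩
      · refine continuousOn_const.add (ContinuousOn.div ?_ ?_ ?_)
        · exact (continuous_finsetSum _ fun i _ => (continuous_evalPoint _).abs).continuousOn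
        · exact (continuous_evalPoint _).abs.continuousOn
        · intro y hy
          exact abs_ne_zero.mpr (ht₁ f hf h0 y hy)
      · have hdeg : (f.map (evalPoint y)).natDegree = f.natDegree :=
          Polynomial.natDegree_map_of_leadingCoeff_ne_zero _ (ht₁ f hf h0 y hy)
        have := abs_le_of_eval_eq_zero hdeg hne hu
        simp only [Polynomial.coeff_map] at this
        exact this
    choose! b hbc hb0 hb using hb
    refine ⟨fun y => ∑ f ∈ F, b f y, ?_, ?_⟩
    · exact continuousOn_finsetSum _ fun f hf => hbc f hf
    · rintro ⟨f, hf⟩ y hy hne u hu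
      exact (hb f hf y hy hne u hu).trans
        (Finset.single_le_sum (f := fun g => b g y) (fun g hg => hb0 g hg y) hf)

theorem eventually_forall_Ioo_eval_ne_zero {p : Polynomial ℝ} (hp : p ≠ 0) :
    ∀ᶠ t₁ in nhdsWithin (0 : ℝ) (Ioi 0), ∀ t ∈ Ioo 0 t₁, p.eval t ≠ 0 := by
  have hfin : ({t : ℝ | p.IsRoot t} \ {0}).Finite :=
    (Polynomial.finite_setOfPred_isRoot hp).subset sdiff_subset
  have h1 : ({t : ℝ | p.IsRoot t} \ {0})ᶜ ∈ nhds (0 : ℝ) :=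
    hfin.isClosed.isOpen_compl.mem_nhds (by simp)
  obtain ⟨ε, hε, h⟩ := Metric.mem_nhds_iff.mp h1
  filter_upwards [Ioo_mem_nhdsGT hε] with t₁ ht₁ t ht h0
  have hmem : t ∈ Metric.ball (0 : ℝ) ε := by
    rw [Metric.mem_ball, Real.dist_eq, sub_zero, abs_of_pos ht.1]
    exact ht.2.trans ht₁.2
  exact h hmem ⟨h0, ht.1.ne'⟩

theorem eventually_sign_eval_eq (p : Polynomial ℝ) :
    ∀ᶠ t₁ in nhdsWithin (0 : ℝ) (Ioi 0), ∀ t ∈ Ioo 0 t₁, ∀ t' ∈ Ioo 0 t₁,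
      SignType.sign (p.eval t) = SignType.sign (p.eval t') := by
  by_cases hp : p = 0
  · simp [hp]
  · filter_upwards [eventually_forall_Ioo_eval_ne_zero hp] with t₁ h t ht t' ht'
    exact sign_eval_eq_of_forall_ne_zero ordConnected_Ioo h ht ht'

/-- For small parameters, every finite family of polynomials admits a good cell decomposition
on whose cells all the polynomials have constant signs. -/
theorem eventually_exists_cellDecomposition (k : ℕ)
    (F : Finset (MvPolynomial (Fin k) (Polynomial ℝ))) :
    ∀ᶠ t₁ in nhdsWithin (0 : ℝ) (Ioi 0),
      ∃ (ι : Type) (_ : Finite ι) (S : ι → Set ((Fin k → ℝ) × ℝ)),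
        CellDecomposition Prod.snd (slab k t₁) S ∧
        ∀ i, ∀ P ∈ F, ∀ p ∈ S i, ∀ q ∈ S i,
          SignType.sign (evalPoint p P) = SignType.sign (evalPoint q P) := by
  classical
  induction k with
  | zero =>
    have h : ∀ P ∈ F, ∀ᶠ t₁ in nhdsWithin (0 : ℝ) (Ioi 0), ∀ p ∈ slab 0 t₁, ∀ q ∈ slab 0 t₁,
        SignType.sign (evalPoint p P) = SignType.sign (evalPoint q P) := by
      intro P _
      filter_upwards [eventually_sign_eval_eq (coeff 0 P)] with t₁ h p hp q hq
      rw [eq_C_of_isEmpty P, evalPoint_C, evalPoint_C]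
      exact h _ hp _ hq
    filter_upwards [(Filter.eventually_all_finset F).mpr h] with t₁ h
    refine ⟨Unit, inferInstance, fun _ => slab 0 t₁, ⟨fun _ => Subset.rfl, fun z hz => ⟨(), hz⟩,
      fun _ _ _ => subset_closure, fun _ => ⟨id, continuousOn_id,
        fun z hz => ⟨subset_closure hz, hz⟩, fun _ _ => rfl, fun _ _ => rfl⟩⟩, fun _ => h⟩
  | succ k ih =>
    set N := F.sup totalDegree + 2 with hN
    set F₁ := F.image fun P => finSuccEquiv _ k (shearHom _ k N P) with hF₁
    have hF₁p : ∀ f ∈ F₁, HasParameterLeadingCoeff f := by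
      intro f hf
      obtain ⟨P, hP, rfl⟩ := Finset.mem_image.mp hf
      by_cases h0 : P = 0
      · left; simp [h0]
      · right
        exact exists_leadingCoeff_finSuccEquiv_shearHom h0
          (by have := Finset.le_sup (f := totalDegree) hP; omega)
    obtain ⟨F₂, hF₁₂, hF₂p, hF₂D⟩ := exists_derivative_closed F₁ hF₁p
    obtain ⟨G, hG⟩ := exists_determinesSignTable F₂
    have hlc : ∀ f ∈ F₂, ∀ᶠ t₁ in nhdsWithin (0 : ℝ) (Ioi 0), f ≠ 0 → ∀ y ∈ slab k t₁,
        evalPoint y f.leadingCoeff ≠ 0 := by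
      intro f hf
      rcases hF₂p f hf with h0 | ⟨c, hc, h⟩
      · exact Filter.Eventually.of_forall fun _ h => absurd h0 h
      · filter_upwards [eventually_forall_Ioo_eval_ne_zero hc] with t₁ ht₁ _ y hy
        rw [h, evalPoint_C]
        exact ht₁ _ hy
    filter_upwards [ih G, (Filter.eventually_all_finset F₂).mpr hlc] with t₁ h1 h2
    obtain ⟨ι, _, S, hS, hSG⟩ := h1
    have hsys := polySystem_of_leadingCoeff_ne_zero hF₂D h2
    have hlift := hS.lift hsys fun i y hy y' hy' => by
      obtain ⟨θ, hθ⟩ := hG (evalPoint y) (evalPoint y') fun c hc => hSG i c hc y hy y' hy'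
      exact ⟨θ, fun j u => hθ j.1 j.2 u⟩
    let Φ : (Fin (k + 1) → ℝ) × ℝ ≃ₜ ((Fin k → ℝ) × ℝ) × ℝ :=
      { toFun := fun p => ((Fin.tail ((shearHomeomorph k N).symm p.1), p.2),
          (shearHomeomorph k N).symm p.1 0)
        invFun := fun q => (shearHomeomorph k N (Fin.cons q.2 q.1.1), q.1.2)
        left_inv := fun p => by simp
        right_inv := fun q => by simp
        continuous_toFun := by
          have := (shearHomeomorph k N).symm.continuous
          have h3 : Continuous fun p : (Fin (k + 1) → ℝ) × ℝ =>
            (shearHomeomorph k N).symm p.1 := by fun_prop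
          refine ((continuous_pi fun i => ?_).prodMk continuous_snd).prodMk ?_
          · exact (continuous_apply i.succ).comp h3
          · exact (continuous_apply 0).comp h3
        continuous_invFun := by
          refine ((shearHomeomorph k N).continuous.comp ?_).prodMk (by fun_prop)
          refine continuous_pi fun i => ?_
          cases i using Fin.cases with
          | zero => simpa using continuous_snd
          | succ i => simp only [Fin.cons_succ]; fun_prop }
    refine ⟨_, inferInstance, _, hlift.preimage Φ, ?_⟩
    rintro ⟨⟨i, τ⟩, hne⟩ P hP p hp q hq
    have hPF : finSuccEquiv _ k (shearHom _ k N P) ∈ F₂ :=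
      hF₁₂ (Finset.mem_image_of_mem _ hP)
    have hsign : ∀ p, Φ p ∈ liftCell (fun (j : F₂) y => j.1.map (evalPoint y)) (S i) τ →
        SignType.sign (evalPoint p P) = τ ⟨_, hPF⟩ := by
      intro p hp
      have h3 := evalPoint_shear (N := N) ((shearHomeomorph k N).symm p.1) p.2 P
      rw [Homeomorph.apply_symm_apply] at h3
      rw [show p = (p.1, p.2) from rfl, h3]
      exact hp.2 ⟨_, hPF⟩
    rw [hsign p hp, hsign q hq]

/-- The intersection of two members of the family is a union of members of the family. -/
def InterCovered {Z : Type*} (𝒦 : Finset (Set Z)) : Prop :=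
  ∀ K ∈ 𝒦, ∀ K' ∈ 𝒦, ∀ p ∈ K ∩ K', ∃ L ∈ 𝒦, p ∈ L ∧ L ⊆ K ∩ K'

theorem InterCovered.filter_ssubset {Z : Type*} [DecidableEq (Set Z)] {𝒦 : Finset (Set Z)}
    (h : InterCovered 𝒦) (K : Set Z) [DecidablePred fun L : Set Z => L ⊂ K] :
    InterCovered (𝒦.filter fun L => L ⊂ K) := by
  intro L hL M hM p hp
  simp only [Finset.mem_filter] at hL hM ⊢
  obtain ⟨N, hN, hpN, hNsub⟩ := h L hL.1 M hM.1 p hp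
  exact ⟨N, ⟨hN, (hNsub.trans inter_subset_left).trans_ssubset hL.2⟩, hpN, hNsub⟩

theorem InterCovered.erase {Z : Type*} [DecidableEq (Set Z)] {𝒦 : Finset (Set Z)}
    (h : InterCovered 𝒦) {K : Set Z} (hK : Maximal (· ∈ 𝒦) K) :
    InterCovered (𝒦.erase K) := by
  intro L hL M hM p hp
  simp only [Finset.mem_erase] at hL hM ⊢
  obtain ⟨N, hN, hpN, hNsub⟩ := h L hL.2 M hM.2 p hp
  refine ⟨N, ⟨?_, hN⟩, hpN, hNsub⟩
  rintro rfl
  exact hL.1 (hK.eq_of_ge hL.2 (hNsub.trans inter_subset_left))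

/-- Members of the family other than a maximal `K` meet `K` in proper submembers of `K`. -/
theorem InterCovered.exists_ssubset {Z : Type*} {𝒦 : Finset (Set Z)}
    (h : InterCovered 𝒦) {K L : Set Z} (hK : Maximal (· ∈ 𝒦) K) (hL : L ∈ 𝒦) (hLK : L ≠ K)
    {p : Z} (hpK : p ∈ K) (hpL : p ∈ L) : ∃ N ∈ 𝒦, p ∈ N ∧ N ⊂ K := by
  obtain ⟨N, hN, hpN, hNsub⟩ := h K hK.1 L hL p ⟨hpK, hpL⟩
  refine ⟨N, hN, hpN, (hNsub.trans inter_subset_left).ssubset_of_ne ?_⟩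
  rintro rfl
  exact hLK (hK.eq_of_ge hL (hNsub.trans inter_subset_right))

theorem continuousOn_piecewise_union {X Y : Type*} [TopologicalSpace X] [TopologicalSpace Y]
    {f g : X → Y} {A B O : Set X} [∀ x, Decidable (x ∈ A)] (hf : ContinuousOn f A)
    (hg : ContinuousOn g B) (hfg : EqOn f g (A ∩ B)) (hA : closure A ∩ O ⊆ A)
    (hB : closure B ∩ O ⊆ B) (hAO : A ⊆ O) (hBO : B ⊆ O) :
    ContinuousOn (A.piecewise f g) (A ∪ B) := by
  have hfA : ContinuousOn (A.piecewise f g) A := hf.congr (piecewise_eqOn A f g)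
  have hgB : ContinuousOn (A.piecewise f g) B := by
    refine hg.congr fun x hx => ?_
    by_cases hxA : x ∈ A
    · rw [piecewise_eq_of_mem _ _ _ hxA, hfg ⟨hxA, hx⟩]
    · rw [piecewise_eq_of_notMem _ _ _ hxA]
  intro x hx
  have hxO : x ∈ O := hx.elim (fun h => hAO h) fun h => hBO h
  refine ContinuousWithinAt.union ?_ ?_
  · by_cases hxA : x ∈ A
    · exact hfA x hxA
    · exact continuousWithinAt_of_notMem_closure fun h => hxA (hA ⟨h, hxO⟩)
  · by_cases hxB : x ∈ B
    · exact hgB x hxB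
    · exact continuousWithinAt_of_notMem_closure fun h => hxB (hB ⟨h, hxO⟩)

theorem exists_continuousOn_extension {X : Type*} [MetricSpace X] {k : ℕ} {A O : Set X}
    (hAO : A ⊆ O) (hA : closure A ∩ O ⊆ A) {f : X → Fin k → ℝ} (hf : ContinuousOn f A) :
    ∃ g : X → Fin k → ℝ, ContinuousOn g O ∧ EqOn g f A := by
  have hcl : IsClosed ((↑) ⁻¹' A : Set O) := by
    have : ((↑) ⁻¹' A : Set O) = (↑) ⁻¹' closure A := by
      ext x
      exact ⟨fun h => subset_closure h, fun h => hA ⟨h, x.2⟩⟩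
    rw [this]
    exact isClosed_closure.preimage continuous_subtype_val
  let φ : C(((↑) ⁻¹' A : Set O), Fin k → ℝ) :=
    ⟨fun x => f x.1.1, hf.comp_continuous (by fun_prop) fun x => x.2⟩
  obtain ⟨G, hG⟩ := φ.exists_restrict_eq hcl
  classical
  refine ⟨fun x => if h : x ∈ O then G ⟨x, h⟩ else 0, ?_, fun x hx => ?_⟩
  · rw [continuousOn_iff_continuous_domRestrict]
    convert G.continuous using 1
    ext x
    simp
  · have := DFunLike.congr_fun hG ⟨⟨x, hAO hx⟩, hx⟩
    simp only [hAO hx, dif_pos]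
    exact this

/-- Maps from closed sets into `X` extend to neighbourhoods. -/
def IsNeighbourhoodExtensor {k : ℕ} (X : Set (Fin k → ℝ)) : Prop :=
  ∀ A : Set (Fin k → ℝ), IsClosed A → ∀ f : (Fin k → ℝ) → Fin k → ℝ, ContinuousOn f A →
    MapsTo f A X → ∃ U, IsOpen U ∧ A ⊆ U ∧ ∃ g : (Fin k → ℝ) → Fin k → ℝ,
      ContinuousOn g U ∧ MapsTo g U X ∧ EqOn g f A

theorem isNeighbourhoodExtensor_empty {k : ℕ} :
    IsNeighbourhoodExtensor (∅ : Set (Fin k → ℝ)) := by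
  intro A _ f _ hfA
  have hA : A = ∅ := eq_empty_of_forall_notMem fun x hx => hfA hx
  subst hA
  exact ⟨∅, isOpen_empty, Subset.rfl, f, continuousOn_empty f, mapsTo_empty f _, eqOn_empty _ _⟩

theorem isNeighbourhoodExtensor_of_retraction {k : ℕ} {X : Set (Fin k → ℝ)}
    {r : (Fin k → ℝ) → Fin k → ℝ} (hr : Continuous r) (hrX : ∀ x, r x ∈ X)
    (hrx : ∀ x ∈ X, r x = x) : IsNeighbourhoodExtensor X := by
  intro A hA f hf hfA
  obtain ⟨g, hg, hgf⟩ := exists_continuousOn_extension (subset_univ A)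
    (by rw [hA.closure_eq]; exact inter_subset_left) hf
  refine ⟨univ, isOpen_univ, subset_univ _, r ∘ g, hr.comp_continuousOn hg, fun x _ => hrX _,
    fun x hx => ?_⟩
  rw [Function.comp_apply, hgf hx, hrx _ (hfA hx)]

theorem IsNeighbourhoodExtensor.union {k : ℕ} {X₁ X₂ : Set (Fin k → ℝ)} (hX₁ : IsClosed X₁)
    (hX₂ : IsClosed X₂) (h₁ : IsNeighbourhoodExtensor X₁) (h₂ : IsNeighbourhoodExtensor X₂)
    (h₀ : IsNeighbourhoodExtensor (X₁ ∩ X₂)) : IsNeighbourhoodExtensor (X₁ ∪ X₂) := by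
  classical
  intro A hA f hf hfA
  set A₁ := A ∩ f ⁻¹' X₁ with hA₁
  set A₂ := A ∩ f ⁻¹' X₂ with hA₂
  have hA₁c : IsClosed A₁ := hf.preimage_isClosed_of_isClosed hA hX₁
  have hA₂c : IsClosed A₂ := hf.preimage_isClosed_of_isClosed hA hX₂
  set M₁ := {x | Metric.infEDist x A₁ ≤ Metric.infEDist x A₂} with hM₁
  set M₂ := {x | Metric.infEDist x A₂ ≤ Metric.infEDist x A₁} with hM₂
  have hM₁c : IsClosed M₁ := isClosed_le Metric.continuous_infEDist Metric.continuous_infEDist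
  have hM₂c : IsClosed M₂ := isClosed_le Metric.continuous_infEDist Metric.continuous_infEDist
  have hM : ∀ x, x ∈ M₁ ∨ x ∈ M₂ := fun x =>
    le_total (Metric.infEDist x A₁) (Metric.infEDist x A₂)
  have hAM₁ : ∀ x ∈ A, x ∈ M₁ → x ∈ A₁ := by
    intro x hx hxM
    rcases hfA hx with h | h
    · exact ⟨hx, h⟩
    · have h0 : Metric.infEDist x A₂ = 0 := Metric.infEDist_zero_of_mem ⟨hx, h⟩
      rw [← hA₁c.closure_eq, Metric.mem_closure_iff_infEDist_zero]
      exact le_antisymm (hxM.trans h0.le) zero_le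
  have hAM₂ : ∀ x ∈ A, x ∈ M₂ → x ∈ A₂ := by
    intro x hx hxM
    rcases hfA hx with h | h
    · have h0 : Metric.infEDist x A₁ = 0 := Metric.infEDist_zero_of_mem ⟨hx, h⟩
      rw [← hA₂c.closure_eq, Metric.mem_closure_iff_infEDist_zero]
      exact le_antisymm (hxM.trans h0.le) zero_le
    · exact ⟨hx, h⟩
  obtain ⟨U₀, hU₀, hAU₀, g₀, hg₀, hg₀X, hg₀f⟩ := h₀ (A₁ ∩ A₂) (hA₁c.inter hA₂c) f
    (hf.mono fun x hx => hx.1.1) fun x hx => ⟨hx.1.2, hx.2.2⟩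
  obtain ⟨v, hv, hAv, hvU⟩ := normal_exists_closure_subset (hA₁c.inter hA₂c) hU₀ hAU₀
  set W := M₁ ∩ M₂ ∩ closure v with hW
  have hWc : IsClosed W := (hM₁c.inter hM₂c).inter isClosed_closure
  have extend : ∀ X' A' : Set (Fin k → ℝ), IsNeighbourhoodExtensor X' → IsClosed A' → A' ⊆ A →
      MapsTo f A' X' → X₁ ∩ X₂ ⊆ X' → ∃ U, IsOpen U ∧ A' ⊆ U ∧ W ⊆ U ∧
        ∃ g : (Fin k → ℝ) → Fin k → ℝ,
        ContinuousOn g U ∧ MapsTo g U X' ∧ EqOn g f A' ∧ EqOn g g₀ W := by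
    intro X' A' hX' hA' hA'A hfA' hXX'
    have hagree : EqOn f g₀ (A' ∩ W) := fun x hx =>
      (hg₀f ⟨hAM₁ x (hA'A hx.1) hx.2.1.1, hAM₂ x (hA'A hx.1) hx.2.1.2⟩).symm
    have hcont := continuousOn_piecewise_union (O := univ) (hf.mono hA'A)
      (hg₀.mono fun x hx => hvU hx.2) hagree
      (by rw [hA'.closure_eq]; exact inter_subset_left)
      (by rw [hWc.closure_eq]; exact inter_subset_left) (subset_univ _) (subset_univ _)
    have hEqW : EqOn (A'.piecewise f g₀) g₀ W := by
      intro x hx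
      by_cases hxA : x ∈ A'
      · rw [piecewise_eq_of_mem _ _ _ hxA, hagree ⟨hxA, hx⟩]
      · rw [piecewise_eq_of_notMem _ _ _ hxA]
    have hEqA : EqOn (A'.piecewise f g₀) f A' := piecewise_eqOn _ _ _
    obtain ⟨U, hU, hAU, g, hg, hgX, hgf⟩ := hX' (A' ∪ W) (hA'.union hWc) _ hcont (by
      rintro x (hx | hx)
      · rw [hEqA hx]; exact hfA' hx
      · rw [hEqW hx]; exact hXX' (hg₀X (hvU hx.2)))
    exact ⟨U, hU, subset_union_left.trans hAU, subset_union_right.trans hAU, g, hg, hgX,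
      (hgf.mono subset_union_left).trans hEqA, (hgf.mono subset_union_right).trans hEqW⟩
  obtain ⟨U₁, hU₁, hAU₁, hWU₁, g₁, hg₁, hg₁X, hg₁f, hg₁W⟩ :=
    extend X₁ A₁ h₁ hA₁c inter_subset_left (fun x hx => hx.2) inter_subset_left
  obtain ⟨U₂, hU₂, hAU₂, hWU₂, g₂, hg₂, hg₂X, hg₂f, hg₂W⟩ :=
    extend X₂ A₂ h₂ hA₂c inter_subset_left (fun x hx => hx.2) inter_subset_right
  set N := (M₁ \ U₁) ∪ (M₂ \ U₂) ∪ ((M₁ ∩ M₂) \ v) with hN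
  have hNc : IsClosed N :=
    ((hM₁c.sdiff hU₁).union (hM₂c.sdiff hU₂)).union ((hM₁c.inter hM₂c).sdiff hv)
  have hN₁ : ∀ x ∈ Nᶜ, x ∈ M₁ → x ∈ U₁ := fun x hx hxM => by
    by_contra h
    exact hx (Or.inl (Or.inl ⟨hxM, h⟩))
  have hN₂ : ∀ x ∈ Nᶜ, x ∈ M₂ → x ∈ U₂ := fun x hx hxM => by
    by_contra h
    exact hx (Or.inl (Or.inr ⟨hxM, h⟩))
  have hN₀ : ∀ x ∈ Nᶜ, x ∈ M₁ → x ∈ M₂ → x ∈ W := fun x hx hx₁ hx₂ => by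
    by_contra h
    exact hx (Or.inr ⟨⟨hx₁, hx₂⟩, fun hv => h ⟨⟨hx₁, hx₂⟩, subset_closure hv⟩⟩)
  have hagree : EqOn g₁ g₂ ((M₁ ∩ Nᶜ) ∩ (M₂ ∩ Nᶜ)) := fun x hx => by
    have := hN₀ x hx.1.2 hx.1.1 hx.2.1
    rw [hg₁W this, hg₂W this]
  have hcont := continuousOn_piecewise_union (O := Nᶜ)
    (hg₁.mono fun x hx => hN₁ x hx.2 hx.1) (hg₂.mono fun x hx => hN₂ x hx.2 hx.1) hagree
    (fun x hx => ⟨closure_minimal inter_subset_left hM₁c hx.1, hx.2⟩)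
    (fun x hx => ⟨closure_minimal inter_subset_left hM₂c hx.1, hx.2⟩)
    inter_subset_right inter_subset_right
  refine ⟨Nᶜ, hNc.isOpen_compl, ?_, _, hcont.mono ?_, ?_, ?_⟩
  · rintro x hx ((⟨h, h'⟩ | ⟨h, h'⟩) | ⟨h, h'⟩)
    · exact h' (hAU₁ (hAM₁ x hx h))
    · exact h' (hAU₂ (hAM₂ x hx h))
    · exact h' (hAv ⟨hAM₁ x hx h.1, hAM₂ x hx h.2⟩)
  · intro x hx
    exact (hM x).imp (fun h => ⟨h, hx⟩) fun h => ⟨h, hx⟩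
  · intro x hx
    by_cases h : x ∈ M₁ ∩ Nᶜ
    · rw [piecewise_eq_of_mem _ _ _ h]
      exact Or.inl (hg₁X (hN₁ x hx h.1))
    · rw [piecewise_eq_of_notMem _ _ _ h]
      exact Or.inr (hg₂X (hN₂ x hx ((hM x).resolve_left fun h' => h ⟨h', hx⟩)))
  · intro x hx
    by_cases h : x ∈ M₁ ∩ Nᶜ
    · rw [piecewise_eq_of_mem _ _ _ h]
      exact hg₁f (hAM₁ x hx h.1)
    · have hxN : x ∈ Nᶜ := by
        rintro ((⟨h, h'⟩ | ⟨h, h'⟩) | ⟨h, h'⟩)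
        · exact h' (hAU₁ (hAM₁ x hx h))
        · exact h' (hAU₂ (hAM₂ x hx h))
        · exact h' (hAv ⟨hAM₁ x hx h.1, hAM₂ x hx h.2⟩)
      rw [piecewise_eq_of_notMem _ _ _ h]
      exact hg₂f (hAM₂ x hx ((hM x).resolve_left fun h' => h ⟨h', hxN⟩))

theorem isNeighbourhoodExtensor_sUnion {k : ℕ} (𝒦 : Finset (Set (Fin k → ℝ)))
    (hi : InterCovered 𝒦) (hc : ∀ K ∈ 𝒦, IsClosed K)
    (h : ∀ K ∈ 𝒦, IsNeighbourhoodExtensor K) :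
    IsNeighbourhoodExtensor (⋃₀ (𝒦 : Set (Set (Fin k → ℝ)))) := by
  classical
  induction 𝒦 using Finset.strongInduction with
  | H 𝒦 ih =>
    rcases 𝒦.eq_empty_or_nonempty with rfl | hne
    · simpa using isNeighbourhoodExtensor_empty
    obtain ⟨K, hK⟩ := 𝒦.exists_maximal hne
    have hKm : K ∈ 𝒦 := hK.1
    have e1 : (⋃₀ (𝒦 : Set (Set (Fin k → ℝ)))) =
        ⋃₀ ((𝒦.erase K : Finset _) : Set (Set (Fin k → ℝ))) ∪ K := by
      rw [union_comm, ← sUnion_insert, ← Finset.coe_insert, Finset.insert_erase hKm]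
    have e2 : ⋃₀ ((𝒦.erase K : Finset _) : Set (Set (Fin k → ℝ))) ∩ K =
        ⋃₀ ((𝒦.filter fun L => L ⊂ K : Finset _) : Set (Set (Fin k → ℝ))) := by
      ext p
      simp only [mem_inter_iff, mem_sUnion, Finset.mem_coe, Finset.mem_erase, Finset.mem_filter]
      constructor
      · rintro ⟨⟨L, ⟨hLK, hL⟩, hpL⟩, hpK⟩
        obtain ⟨N, hN, hpN, hNK⟩ := hi.exists_ssubset hK hL hLK hpK hpL
        exact ⟨N, ⟨hN, hNK⟩, hpN⟩
      · rintro ⟨L, ⟨hL, hLK⟩, hpL⟩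
        exact ⟨⟨L, ⟨hLK.ne, hL⟩, hpL⟩, hLK.subset hpL⟩
    rw [e1]
    refine IsNeighbourhoodExtensor.union ?_ (hc K hKm) ?_ (h K hKm) ?_
    · rw [sUnion_eq_biUnion]
      exact (Finset.finite_toSet _).isClosed_biUnion fun L hL => hc L (Finset.mem_of_mem_erase hL)
    · exact ih _ (Finset.erase_ssubset hKm) (hi.erase hK)
        (fun L hL => hc L (Finset.mem_of_mem_erase hL))
        fun L hL => h L (Finset.mem_of_mem_erase hL)
    · rw [e2]
      refine ih _ (Finset.filter_ssubset.mpr ⟨K, hKm, fun h => h.ne rfl⟩) (hi.filter_ssubset K)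
        (fun L hL => hc L (Finset.mem_filter.mp hL).1)
        fun L hL => h L (Finset.mem_filter.mp hL).1

/-- A finite family of relatively closed subsets of the slab which are retracts along the fibres
of the parameter. -/
structure IsFibreRetractFamily {k : ℕ} (t₁ : ℝ) (𝒦 : Finset (Set ((Fin k → ℝ) × ℝ))) : Prop where
  inter : InterCovered 𝒦
  subset : ∀ K ∈ 𝒦, K ⊆ slab k t₁
  closed : ∀ K ∈ 𝒦, closure K ∩ slab k t₁ ⊆ K
  retraction : ∀ K ∈ 𝒦, ∃ r : (Fin k → ℝ) × ℝ → (Fin k → ℝ) × ℝ, ContinuousOn r (slab k t₁) ∧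
    (∀ z ∈ slab k t₁, r z ∈ K) ∧ (∀ z ∈ slab k t₁, (r z).2 = z.2) ∧ ∀ z ∈ K, r z = z

theorem eventually_exists_isFibreRetractFamily {k : ℕ}
    (F : Finset (MvPolynomial (Fin k) (Polynomial ℝ))) {C : Set ((Fin k → ℝ) × ℝ)}
    (hC : IsClosed C) (hCF : ∀ p q, (∀ P ∈ F,
      SignType.sign (evalPoint p P) = SignType.sign (evalPoint q P)) → p ∈ C → q ∈ C) :
    ∀ᶠ t₁ in nhdsWithin (0 : ℝ) (Ioi 0), ∃ 𝒦 : Finset (Set ((Fin k → ℝ) × ℝ)),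
      IsFibreRetractFamily t₁ 𝒦 ∧ ⋃₀ (𝒦 : Set (Set ((Fin k → ℝ) × ℝ))) = C ∩ slab k t₁ := by
  classical
  filter_upwards [eventually_exists_cellDecomposition k F] with t₁ h
  obtain ⟨ι, _, S, hS, hSF⟩ := h
  have := Fintype.ofFinite ι
  set 𝒦 : Finset (Set ((Fin k → ℝ) × ℝ)) :=
    (Finset.univ.image fun i => closure (S i) ∩ slab k t₁).filter fun K => K ⊆ C with h𝒦
  have hmem : ∀ K, K ∈ 𝒦 ↔ (∃ i, closure (S i) ∩ slab k t₁ = K) ∧ K ⊆ C := by simp [h𝒦]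
  refine ⟨𝒦, ⟨?_, ?_, ?_, ?_⟩, ?_⟩
  · intro K hK L hL p hp
    rw [hmem] at hK hL
    obtain ⟨⟨i, rfl⟩, hi⟩ := hK
    obtain ⟨⟨j, rfl⟩, hj⟩ := hL
    obtain ⟨l, hl⟩ := hS.cover p hp.1.2
    have hli : closure (S l) ⊆ closure (S i) :=
      closure_minimal (hS.frontier i l ⟨p, hl, hp.1.1⟩) isClosed_closure
    have hlj : closure (S l) ⊆ closure (S j) :=
      closure_minimal (hS.frontier j l ⟨p, hl, hp.2.1⟩) isClosed_closure
    refine ⟨closure (S l) ∩ slab k t₁, ?_, ⟨subset_closure hl, hp.1.2⟩,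
      subset_inter (inter_subset_inter_left _ hli) (inter_subset_inter_left _ hlj)⟩
    rw [hmem]
    exact ⟨⟨l, rfl⟩, (inter_subset_inter_left _ hli).trans hi⟩
  · intro K hK
    obtain ⟨⟨i, rfl⟩, -⟩ := (hmem K).mp hK
    exact inter_subset_right
  · intro K hK
    obtain ⟨⟨i, rfl⟩, -⟩ := (hmem K).mp hK
    exact inter_subset_inter_left _ (closure_minimal inter_subset_left isClosed_closure)
  · intro K hK
    obtain ⟨⟨i, rfl⟩, -⟩ := (hmem K).mp hK
    exact hS.retraction i
  · refine subset_antisymm (sUnion_subset fun K hK => ?_) fun p hp => ?_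
    · obtain ⟨⟨i, rfl⟩, hi⟩ := (hmem K).mp hK
      exact subset_inter hi inter_subset_right
    · obtain ⟨i, hi⟩ := hS.cover p hp.2
      refine ⟨closure (S i) ∩ slab k t₁, (hmem _).mpr ⟨⟨i, rfl⟩, ?_⟩, subset_closure hi, hp.2⟩
      refine inter_subset_left.trans (closure_minimal (fun q hq => ?_) hC)
      exact hCF p q (fun P hP => hSF i P hP p hi q hq) hp.1

theorem IsFibreRetractFamily.isNeighbourhoodExtensor_slice {k : ℕ} {t₁ : ℝ}
    {𝒦 : Finset (Set ((Fin k → ℝ) × ℝ))} (h : IsFibreRetractFamily t₁ 𝒦) {t : ℝ}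
    (ht : t ∈ Ioo 0 t₁) :
    IsNeighbourhoodExtensor {x | (x, t) ∈ ⋃₀ (𝒦 : Set (Set ((Fin k → ℝ) × ℝ)))} := by
  classical
  have hcont : Continuous fun x : Fin k → ℝ => (x, t) := by fun_prop
  have hslab : ∀ x : Fin k → ℝ, (x, t) ∈ slab k t₁ := fun _ => ht
  convert isNeighbourhoodExtensor_sUnion (𝒦.image fun K => {x | (x, t) ∈ K}) ?_ ?_ ?_ using 1
  · ext x; simp
  · intro K' hK' L' hL' p hp
    obtain ⟨K, hK, rfl⟩ := Finset.mem_image.mp hK'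
    obtain ⟨L, hL, rfl⟩ := Finset.mem_image.mp hL'
    obtain ⟨N, hN, hpN, hNsub⟩ := h.inter K hK L hL (p, t) hp
    exact ⟨_, Finset.mem_image_of_mem _ hN, hpN, fun x hx => hNsub hx⟩
  · intro K' hK'
    obtain ⟨K, hK, rfl⟩ := Finset.mem_image.mp hK'
    have : {x | (x, t) ∈ K} = (fun x => (x, t)) ⁻¹' closure K := by
      ext x
      exact ⟨fun hx => subset_closure hx, fun hx => h.closed K hK ⟨hx, hslab x⟩⟩
    rw [this]
    exact isClosed_closure.preimage hcont
  · intro K' hK'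
    obtain ⟨K, hK, rfl⟩ := Finset.mem_image.mp hK'
    obtain ⟨r, hr, hrK, hr2, hrz⟩ := h.retraction K hK
    refine isNeighbourhoodExtensor_of_retraction (r := fun x => (r (x, t)).1) ?_ ?_ ?_
    · exact continuous_fst.comp (hr.comp_continuous hcont hslab)
    · intro x
      have h1 : r (x, t) = ((r (x, t)).1, t) := Prod.ext rfl (hr2 _ (hslab x))
      change ((r (x, t)).1, t) ∈ K
      rw [← h1]
      exact hrK _ (hslab x)
    · intro x hx
      rw [hrz _ hx]

/-- The union of a fibre retract family can be moved continuously to any other parameter. -/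
theorem IsFibreRetractFamily.exists_transport {k : ℕ} {t₁ : ℝ}
    {𝒦 : Finset (Set ((Fin k → ℝ) × ℝ))} (h : IsFibreRetractFamily t₁ 𝒦) :
    ∃ H : ((Fin k → ℝ) × ℝ) × ℝ → Fin k → ℝ,
      ContinuousOn H (⋃₀ (𝒦 : Set (Set ((Fin k → ℝ) × ℝ))) ×ˢ Ioo 0 t₁) ∧
      (∀ K ∈ 𝒦, ∀ p ∈ K, ∀ s ∈ Ioo 0 t₁, (H (p, s), s) ∈ K) ∧
      ∀ p ∈ ⋃₀ (𝒦 : Set (Set ((Fin k → ℝ) × ℝ))), H (p, p.2) = p.1 := by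
  classical
  induction 𝒦 using Finset.strongInduction with
  | H 𝒦 ih =>
    rcases 𝒦.eq_empty_or_nonempty with rfl | hne
    · exact ⟨fun _ => 0, continuousOn_const, by simp, by simp⟩
    obtain ⟨K, hK⟩ := 𝒦.exists_maximal hne
    have hKm : K ∈ 𝒦 := hK.1
    obtain ⟨H₀, hH₀c, hH₀K, hH₀d⟩ := ih _ (Finset.erase_ssubset hKm)
      ⟨h.inter.erase hK, fun L hL => h.subset L (Finset.mem_of_mem_erase hL),
        fun L hL => h.closed L (Finset.mem_of_mem_erase hL),
        fun L hL => h.retraction L (Finset.mem_of_mem_erase hL)⟩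
    obtain ⟨r, hr, hrK, hr2, hrz⟩ := h.retraction K hKm
    set X : Set ((Fin k → ℝ) × ℝ) :=
      ⋃₀ ((𝒦.erase K : Finset _) : Set (Set ((Fin k → ℝ) × ℝ))) with hX
    have e1 : ⋃₀ (𝒦 : Set (Set ((Fin k → ℝ) × ℝ))) = X ∪ K := by
      rw [union_comm, hX, ← sUnion_insert, ← Finset.coe_insert, Finset.insert_erase hKm]
    have hXE : X ⊆ slab k t₁ := sUnion_subset fun L hL => h.subset L (Finset.mem_of_mem_erase hL)
    have hKE : K ⊆ slab k t₁ := h.subset K hKm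
    have hXc : closure X ∩ slab k t₁ ⊆ X := by
      rintro p ⟨hp, hpE⟩
      rw [hX, sUnion_eq_biUnion, (Finset.finite_toSet _).closure_biUnion] at hp
      obtain ⟨L, hL, hpL⟩ := mem_iUnion₂.mp hp
      exact ⟨L, hL, h.closed L (Finset.mem_of_mem_erase hL) ⟨hpL, hpE⟩⟩
    set O : Set (((Fin k → ℝ) × ℝ) × ℝ) := slab k t₁ ×ˢ Ioo 0 t₁ with hO
    set Δ : Set (((Fin k → ℝ) × ℝ) × ℝ) := O ∩ {q | q.1.2 = q.2} with hΔ
    have hΔc : closure Δ ∩ O ⊆ Δ := fun q hq =>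
      ⟨hq.2, closure_minimal inter_subset_right
        (isClosed_eq (by fun_prop) (by fun_prop)) hq.1⟩
    have hprodc : ∀ Y : Set ((Fin k → ℝ) × ℝ), closure Y ∩ slab k t₁ ⊆ Y →
        closure (Y ×ˢ Ioo 0 t₁) ∩ O ⊆ Y ×ˢ Ioo 0 t₁ := by
      rintro Y hY q ⟨hq, hqO⟩
      rw [closure_prod_eq] at hq
      exact ⟨hY ⟨hq.1, hqO.1⟩, hqO.2⟩
    have hXO : X ×ˢ Ioo 0 t₁ ⊆ O := prod_mono_left hXE
    have hKO : K ×ˢ Ioo 0 t₁ ⊆ O := prod_mono_left hKE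
    have hcont := continuousOn_piecewise_union (O := O) (g := fun q => q.1.1) (B := Δ) hH₀c
      (by fun_prop) (by
        rintro ⟨p, s⟩ ⟨⟨hpX, _⟩, _, hps⟩
        change p.2 = s at hps
        subst hps
        exact hH₀d p hpX) (hprodc X hXc) hΔc hXO inter_subset_left
    obtain ⟨G, hGc, hG⟩ := exists_continuousOn_extension
      (union_subset hXO inter_subset_left)
      (by
        rw [closure_union, union_inter_distrib_right]
        exact union_subset_union (hprodc X hXc) hΔc) hcont
    have hGX : EqOn G H₀ (X ×ˢ Ioo 0 t₁) := fun q hq => by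
      rw [hG (Or.inl hq), piecewise_eq_of_mem _ _ _ hq]
    have hGΔ : ∀ p ∈ slab k t₁, G (p, p.2) = p.1 := by
      intro p hp
      have hpΔ : (p, p.2) ∈ Δ := ⟨⟨hp, hp⟩, rfl⟩
      by_cases hpX : p ∈ X
      · rw [hGX (show (p, p.2) ∈ X ×ˢ Ioo 0 t₁ from ⟨hpX, hp⟩), hH₀d p hpX]
      · rw [hG (Or.inr hpΔ), piecewise_eq_of_notMem _ _ _ fun h => hpX h.1]
    set R : ((Fin k → ℝ) × ℝ) × ℝ → Fin k → ℝ := fun q => (r (G q, q.2)).1 with hR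
    have hRc : ContinuousOn R O :=
      continuous_fst.comp_continuousOn
        (hr.comp (hGc.prodMk continuous_snd.continuousOn) fun q hq => hq.2)
    have hRK : ∀ q ∈ O, (R q, q.2) ∈ K := by
      intro q hq
      have h1 : r (G q, q.2) = (R q, q.2) := Prod.ext rfl (hr2 _ hq.2)
      rw [← h1]
      exact hrK _ hq.2
    have hagree : EqOn H₀ R ((X ×ˢ Ioo 0 t₁) ∩ (K ×ˢ Ioo 0 t₁)) := by
      rintro ⟨p, s⟩ ⟨⟨⟨L, hL, hpL⟩, hs⟩, hpK, _⟩
      have hL' := Finset.mem_erase.mp hL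
      obtain ⟨N, hN, hpN, hNK⟩ := h.inter.exists_ssubset hK hL'.2 hL'.1 hpK hpL
      have h1 := hNK.subset (hH₀K N (Finset.mem_erase.mpr ⟨hNK.ne, hN⟩) p hpN s hs)
      simp only [hR]
      rw [hGX ⟨⟨L, hL, hpL⟩, hs⟩, hrz _ h1]
    refine ⟨(X ×ˢ Ioo 0 t₁).piecewise H₀ R, ?_, ?_, ?_⟩
    · rw [e1, union_prod]
      exact continuousOn_piecewise_union hH₀c (hRc.mono hKO) hagree (hprodc X hXc)
        (hprodc K (h.closed K hKm)) hXO hKO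
    · intro L hL p hp s hs
      by_cases hLK : L = K
      · subst hLK
        by_cases hpX : (p, s) ∈ X ×ˢ Ioo 0 t₁
        · rw [piecewise_eq_of_mem _ _ _ hpX, hagree ⟨hpX, hp, hs⟩]
          exact hRK _ (hKO ⟨hp, hs⟩)
        · rw [piecewise_eq_of_notMem _ _ _ hpX]
          exact hRK _ (hKO ⟨hp, hs⟩)
      · have hL' := Finset.mem_erase.mpr ⟨hLK, hL⟩
        rw [piecewise_eq_of_mem _ _ _ (show (p, s) ∈ X ×ˢ Ioo 0 t₁ from ⟨⟨L, hL', hp⟩, hs⟩)]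
        exact hH₀K L hL' p hp s hs
    · rw [e1]
      intro p hp
      have hpE : p ∈ slab k t₁ := hp.elim (fun h => hXE h) fun h => hKE h
      by_cases hpX : p ∈ X
      · rw [piecewise_eq_of_mem _ _ _ (show (p, p.2) ∈ X ×ˢ Ioo 0 t₁ from ⟨hpX, hpE⟩), hH₀d p hpX]
      · rw [piecewise_eq_of_notMem _ _ _ fun h => hpX h.1]
        simp only [hR]
        rw [hGΔ p hpE, hrz p (hp.resolve_left hpX)]

theorem isNeighbourhoodExtensor_of_sign_determined {k : ℕ}
    (F : Finset (MvPolynomial (Fin k) ℝ)) {X : Set (Fin k → ℝ)} (hX : IsClosed X)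
    (hXF : ∀ x y, (∀ P ∈ F, SignType.sign (eval x P) = SignType.sign (eval y P)) →
      x ∈ X → y ∈ X) : IsNeighbourhoodExtensor X := by
  classical
  have heval : ∀ (p : (Fin k → ℝ) × ℝ) (P : MvPolynomial (Fin k) ℝ),
      evalPoint p (map Polynomial.C P) = eval p.1 P := by
    intro p P
    have hid : (Polynomial.evalRingHom p.2).comp Polynomial.C = RingHom.id ℝ := by
      ext a
      simp
    rw [evalPoint, coe_eval₂Hom, eval₂_map, hid, eval₂_id]
  have hev := eventually_exists_isFibreRetractFamily (F.image (map Polynomial.C))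
    (C := Prod.fst ⁻¹' X) (hX.preimage continuous_fst) fun p q hpq hp =>
      hXF p.1 q.1 (fun P hP => by
        have := hpq _ (Finset.mem_image_of_mem _ hP)
        rwa [heval, heval] at this) hp
  obtain ⟨t₁, ⟨𝒦, h𝒦, hU⟩, ht₁⟩ := (hev.and self_mem_nhdsWithin).exists
  have ht₁ : 0 < t₁ := ht₁
  have ht : t₁ / 2 ∈ Ioo 0 t₁ := ⟨by linarith, by linarith⟩
  convert h𝒦.isNeighbourhoodExtensor_slice ht using 1
  ext x
  rw [mem_ofPred_eq, hU]
  exact ⟨fun hx => ⟨hx, ht⟩, fun hx => hx.1⟩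

theorem IsNeighbourhoodExtensor.exists_retraction {k : ℕ} {X : Set (Fin k → ℝ)}
    (h : IsNeighbourhoodExtensor X) (hX : IsClosed X) :
    ∃ U, IsOpen U ∧ X ⊆ U ∧ ∃ ρ : (Fin k → ℝ) → Fin k → ℝ,
      ContinuousOn ρ U ∧ MapsTo ρ U X ∧ ∀ x ∈ X, ρ x = x :=
  h X hX id continuousOn_id (mapsTo_id X)

/-- The signs of the coefficients determine the sign of a polynomial near `0` from the right. -/
theorem eventually_sign_eval_eq_of_sign_coeff_eq (d : ℕ) :
    ∀ p q : Polynomial ℝ, p.natDegree ≤ d → q.natDegree ≤ d →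
      (∀ n, SignType.sign (p.coeff n) = SignType.sign (q.coeff n)) →
      ∀ᶠ t in nhdsWithin (0 : ℝ) (Ioi 0),
        SignType.sign (p.eval t) = SignType.sign (q.eval t) := by
  have hcont : ∀ p : Polynomial ℝ, p.coeff 0 ≠ 0 → ∀ᶠ t in nhdsWithin (0 : ℝ) (Ioi 0),
      SignType.sign (p.eval t) = SignType.sign (p.coeff 0) := by
    intro p hp
    rw [Polynomial.coeff_zero_eq_eval_zero] at hp ⊢
    have h1 : Filter.Tendsto (fun t => p.eval t) (nhdsWithin 0 (Ioi 0)) (nhds (p.eval 0)) :=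
      p.continuous.continuousAt.tendsto.mono_left nhdsWithin_le_nhds
    rcases lt_or_gt_of_ne hp with h | h
    · filter_upwards [h1.eventually (gt_mem_nhds h)] with t ht
      rw [sign_neg ht, sign_neg h]
    · filter_upwards [h1.eventually (lt_mem_nhds h)] with t ht
      rw [sign_pos ht, sign_pos h]
  induction d with
  | zero =>
    intro p q hp hq hpq
    rw [Polynomial.eq_C_of_natDegree_le_zero hp, Polynomial.eq_C_of_natDegree_le_zero hq]
    simpa using hpq 0
  | succ d ih =>
    intro p q hp hq hpq
    by_cases h0 : p.coeff 0 = 0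
    · have h0' : q.coeff 0 = 0 := by
        rw [← sign_eq_zero_iff, ← hpq 0, h0, sign_zero]
      have h := ih p.divX q.divX
        (by rw [Polynomial.natDegree_divX_eq_natDegree_tsub_one]; omega)
        (by rw [Polynomial.natDegree_divX_eq_natDegree_tsub_one]; omega)
        (fun n => by rw [Polynomial.coeff_divX, Polynomial.coeff_divX, hpq])
      filter_upwards [h] with t ht
      rw [← p.divX_mul_X_add, ← q.divX_mul_X_add, h0, h0']
      simp [sign_mul, ht]
    · have h0' : q.coeff 0 ≠ 0 := by
        rwa [← sign_ne_zero, ← hpq 0, sign_ne_zero]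
      filter_upwards [hcont p h0, hcont q h0'] with t hp hq
      rw [hp, hq, hpq]

theorem homotopic_of_continuousOn {V : Type*} [TopologicalSpace V] {X Y : Set V} (f g : C(X, Y))
    {a b : ℝ} (hab : a ≤ b) (Φ : ℝ × V → V) (hΦ : ContinuousOn Φ (Icc a b ×ˢ X))
    (hΦY : MapsTo Φ (Icc a b ×ˢ X) Y) (hf : ∀ x : X, Φ (a, x) = f x)
    (hg : ∀ x : X, Φ (b, x) = g x) : f.Homotopic g := by
  have hmem : ∀ p : unitInterval × X,
      (a + (p.1 : ℝ) * (b - a), (p.2 : V)) ∈ Icc a b ×ˢ X := by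
    rintro ⟨⟨l, hl0, hl1⟩, x⟩
    exact ⟨⟨by simp only; nlinarith, by simp only; nlinarith⟩, x.2⟩
  refine ⟨⟨⟨fun p => ⟨Φ (a + (p.1 : ℝ) * (b - a), p.2), hΦY (hmem p)⟩, ?_⟩, ?_, ?_⟩⟩
  · exact (hΦ.comp_continuous (by fun_prop) hmem).subtype_mk _
  · intro x
    ext1
    simpa using hf x
  · intro x
    ext1
    simpa using hg x

/-- An increasing family with compact slices is homotopy equivalent to its limit as soon as the
slices can be transported and everything in sight is a neighbourhood extensor. -/
theorem exists_homotopyEquiv_of_transport {k : ℕ} {B : Set (Fin k → ℝ)}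
    {C : ℝ → Set (Fin k → ℝ)} {t : ℝ} (ht : 0 < t)
    (hmono : ∀ s s', 0 < s → s ≤ s' → s' ≤ t → C s ⊆ C s')
    (hC : ∀ s, IsCompact (C s)) (hB : B = ⋂ s ∈ Ioc 0 t, C s)
    (hBe : IsNeighbourhoodExtensor B) (hCe : IsNeighbourhoodExtensor (C t))
    (H : ((Fin k → ℝ) × ℝ) × ℝ → Fin k → ℝ)
    (hH : ContinuousOn H {q | q.1.2 ∈ Ioc 0 t ∧ q.2 ∈ Ioc 0 t ∧ q.1.1 ∈ C q.1.2})
    (hHC : ∀ x, ∀ τ ∈ Ioc 0 t, ∀ s ∈ Ioc 0 t, x ∈ C τ → H ((x, τ), s) ∈ C s)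
    (hHd : ∀ x, ∀ τ ∈ Ioc 0 t, x ∈ C τ → H ((x, τ), τ) = x) :
    ∃ e : ContinuousMap.HomotopyEquiv B (C t),
      ∀ x : B, (e.toFun x : Fin k → ℝ) = (x : Fin k → ℝ) := by
  have htt : t ∈ Ioc 0 t := ⟨ht, le_rfl⟩
  have hBC : ∀ s ∈ Ioc 0 t, B ⊆ C s := fun s hs => by
    rw [hB]; exact biInter_subset_of_mem hs
  have hBcl : IsClosed B := by
    rw [hB]; exact isClosed_biInter fun s _ => (hC s).isClosed
  have hBc : IsCompact B := (hC t).of_isClosed_subset hBcl (hBC t htt)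
  obtain ⟨U, hU, hBU, ρ, hρ, hρB, hρid⟩ := hBe.exists_retraction hBcl
  obtain ⟨U', hU', hCU', ρ', hρ', hρC, hρid'⟩ := hCe.exists_retraction (hC t).isClosed
  obtain ⟨ε, hε, hεU⟩ := hBc.exists_thickening_subset_open hU' ((hBC t htt).trans hCU')
  have hWo : IsOpen (U ∩ (fun x => dist x (ρ x)) ⁻¹' Iio ε) :=
    (continuous_dist.comp_continuousOn (continuousOn_id.prodMk hρ)).isOpen_inter_preimage hU isOpen_Iio
  set W := U ∩ (fun x => dist x (ρ x)) ⁻¹' Iio ε with hW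
  have hBW : B ⊆ W := fun x hx => ⟨hBU hx, by simpa [hρid x hx] using hε⟩
  obtain ⟨s, hs0, hst, hsW⟩ : ∃ s, 0 < s ∧ s ≤ t ∧ C s ⊆ W := by
    have : Nonempty (Ioc 0 t) := ⟨⟨t, htt⟩⟩
    obtain ⟨s, hs⟩ := exists_subset_nhds_of_isCompact (V := fun s : Ioc 0 t => C s)
      (fun s s' => by
        rcases le_total s s' with h | h
        · exact ⟨s, Subset.rfl, hmono _ _ s.2.1 h s'.2.2⟩
        · exact ⟨s', hmono _ _ s'.2.1 h s.2.2, Subset.rfl⟩)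
      (fun s => hC s) (U := W) (fun x hx => hWo.mem_nhds (hBW (by
        rw [hB]
        exact mem_iInter₂.mpr fun s hs => mem_iInter.mp hx ⟨s, hs⟩)))
    exact ⟨s, s.2.1, s.2.2, hs⟩
  have hss : s ∈ Ioc 0 t := ⟨hs0, hst⟩
  have hh : ContinuousOn (fun x => H ((x, t), s)) (C t) :=
    hH.comp (by fun_prop) fun x hx => ⟨htt, hss, hx⟩
  have hhW : ∀ x ∈ C t, H ((x, t), s) ∈ W := fun x hx => hsW (hHC x t htt s hss hx)
  have hρh : ContinuousOn (fun x => ρ (H ((x, t), s))) (C t) :=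
    hρ.comp hh fun x hx => (hhW x hx).1
  let i : C(B, C t) := ⟨fun x => ⟨x, hBC t htt x.2⟩, by fun_prop⟩
  let j : C(C t, B) := ⟨fun x => ⟨ρ (H ((x, t), s)), hρB (hhW x x.2).1⟩,
    (hρh.comp_continuous continuous_subtype_val fun x => x.2).subtype_mk _⟩
  let h : C(C t, C t) := ⟨fun x => ⟨H ((x, t), s),
      hmono s t hs0 hst le_rfl (hHC x t htt s hss x.2)⟩,
    (hh.comp_continuous continuous_subtype_val fun x => x.2).subtype_mk _⟩
  refine ⟨⟨i, j, ?_, ?_⟩, fun x => rfl⟩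
  · refine (homotopic_of_continuousOn (.id B) (j.comp i) hst
      (fun p => ρ (H ((p.2, p.1), s))) ?_ ?_ ?_ fun x => rfl).symm
    · refine hρ.comp (hH.comp (by fun_prop) ?_) ?_
      · rintro ⟨τ, x⟩ ⟨hτ, hx⟩
        have hτ' : τ ∈ Ioc 0 t := ⟨hs0.trans_le hτ.1, hτ.2⟩
        exact ⟨hτ', hss, hBC τ hτ' hx⟩
      · rintro ⟨τ, x⟩ ⟨hτ, hx⟩
        have hτ' : τ ∈ Ioc 0 t := ⟨hs0.trans_le hτ.1, hτ.2⟩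
        exact (hsW (hHC x τ hτ' s hss (hBC τ hτ' hx))).1
    · rintro ⟨τ, x⟩ ⟨hτ, hx⟩
      have hτ' : τ ∈ Ioc 0 t := ⟨hs0.trans_le hτ.1, hτ.2⟩
      exact hρB (hsW (hHC x τ hτ' s hss (hBC τ hτ' hx))).1
    · intro x
      simp only [hHd x s hss (hBC s hss x.2), hρid x x.2]
      rfl
  · have hseg : ∀ l ∈ Icc (0 : ℝ) 1, ∀ x ∈ C t,
        ρ (H ((x, t), s)) + l • (H ((x, t), s) - ρ (H ((x, t), s))) ∈ U' := by
      intro l hl x hx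
      refine hεU (Metric.mem_thickening_iff.mpr ⟨_, hρB (hhW x hx).1, ?_⟩)
      rw [dist_eq_norm, add_sub_cancel_left, norm_smul, ← dist_eq_norm, Real.norm_of_nonneg hl.1]
      have h1 : dist (H ((x, t), s)) (ρ (H ((x, t), s))) < ε := (hhW x hx).2
      exact (mul_le_of_le_one_left dist_nonneg hl.2).trans_lt h1
    have h1 : (i.comp j).Homotopic h := by
      refine homotopic_of_continuousOn _ _ zero_le_one
        (fun p => ρ' (ρ (H ((p.2, t), s)) + p.1 • (H ((p.2, t), s) - ρ (H ((p.2, t), s)))))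
        ?_ ?_ ?_ ?_
      · have hc1 : ContinuousOn (fun p : ℝ × (Fin k → ℝ) => ρ (H ((p.2, t), s)))
            (Icc 0 1 ×ˢ C t) := hρh.comp continuousOn_snd fun p hp => hp.2
        have hc2 : ContinuousOn (fun p : ℝ × (Fin k → ℝ) => H ((p.2, t), s))
            (Icc 0 1 ×ˢ C t) := hh.comp continuousOn_snd fun p hp => hp.2
        exact hρ'.comp (hc1.add (continuousOn_fst.smul (hc2.sub hc1)))
          fun p hp => hseg p.1 hp.1 p.2 hp.2
      · exact fun p hp => hρC (hseg p.1 hp.1 p.2 hp.2)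
      · intro x
        simp only [zero_smul, add_zero]
        exact hρid' _ (i (j x)).2
      · intro x
        simp only [one_smul, add_sub_cancel]
        exact hρid' _ (h x).2
    refine h1.trans (homotopic_of_continuousOn _ _ hst (fun p => H ((p.2, t), p.1)) ?_ ?_ ?_ ?_)
    · refine hH.comp (by fun_prop) ?_
      rintro ⟨τ, x⟩ ⟨hτ, hx⟩
      exact ⟨htt, ⟨hs0.trans_le hτ.1, hτ.2⟩, hx⟩
    · rintro ⟨τ, x⟩ ⟨hτ, hx⟩
      have hτ' : τ ∈ Ioc 0 t := ⟨hs0.trans_le hτ.1, hτ.2⟩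
      exact hmono τ t hτ'.1 hτ.2 le_rfl (hHC x t htt τ hτ' hx)
    · exact fun x => rfl
    · exact fun x => hHd x t htt x.2

theorem map_aeval_snoc {R : Type*} [CommRing R] [Algebra ℝ R] {k : ℕ} (φ : R →+* ℝ)
    (hφ : ∀ r, φ (algebraMap ℝ R r) = r) {v : Fin k → R} {w : R} {x : Fin k → ℝ} {t : ℝ}
    (hv : ∀ j, φ (v j) = x j) (hw : φ w = t) (P : MvPolynomial (Fin (k + 1)) ℝ) :
    φ (aeval (Fin.snoc v w : Fin (k + 1) → R) P) =
      eval (Fin.snoc x t : Fin (k + 1) → ℝ) P := by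
  induction P using MvPolynomial.induction_on with
  | C r => simp [hφ]
  | add P Q hP hQ => simp [hP, hQ]
  | mul_X P i hP =>
    rw [map_mul, map_mul, hP, map_mul, aeval_X, eval_X]
    congr 1
    cases i using Fin.lastCases with
    | last => simpa using hw
    | cast j => simpa using hv j

/-- Let `C ⊆ ℝ^k × ℝ` be a closed and bounded set which is a finite union of realizations of
sign conditions on a finite family `A` of polynomials in `ℝ[X_1,…,X_k,T]`.  If the slices
`C_t = {x | (x,t) ∈ C}` are increasing for `0 < t < t' < t₀`, and `B = ⋂_{0<t<t₀} C_t`, then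
for all sufficiently small `t > 0` the set `B` is contained in `C_t` and the inclusion
`B ↪ C_t` is a homotopy equivalence. -/
theorem monotone_semialgebraic_family_homotopy_equivalence {k n : ℕ}
    (A : Fin n → MvPolynomial (Fin (k + 1)) ℝ)
    (C : Set ((Fin k → ℝ) × ℝ))
    (hCclosed : IsClosed C) (hCbdd : Bornology.IsBounded C)
    (Sgns : Set (Fin n → SignType))
    (hCsa : C = ⋃ σ ∈ Sgns, {p : (Fin k → ℝ) × ℝ |
        ∀ i, SignType.sign (eval (Fin.snoc p.1 p.2) (A i)) = σ i})
    (t₀ : ℝ) (ht₀ : 0 < t₀)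
    (hmono : ∀ t t' : ℝ, 0 < t → t < t' → t' < t₀ →
        {x | (x, t) ∈ C} ⊆ {x | (x, t') ∈ C})
    (B : Set (Fin k → ℝ)) (hB : B = ⋂ t ∈ Ioo (0 : ℝ) t₀, {x | (x, t) ∈ C}) :
    ∃ t₁ ∈ Ioo (0 : ℝ) t₀, ∀ t ∈ Ioo (0 : ℝ) t₁,
      B ⊆ {x | (x, t) ∈ C} ∧
      ∃ e : ContinuousMap.HomotopyEquiv B {x | (x, t) ∈ C},
        ∀ x : B, (e.toFun x : Fin k → ℝ) = (x : Fin k → ℝ) := by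
  classical
  set e : Fin n → (Fin k → ℝ) × ℝ → ℝ := fun i p => eval (Fin.snoc p.1 p.2) (A i) with he
  have hmem : ∀ p, p ∈ C ↔ (fun i => SignType.sign (e i p)) ∈ Sgns := by
    intro p
    rw [hCsa]
    simp only [mem_iUnion, mem_ofPred_eq, exists_prop]
    constructor
    · rintro ⟨σ, hσ, h⟩
      rwa [show (fun i => SignType.sign (e i p)) = σ from funext h]
    · exact fun h => ⟨_, h, fun i => rfl⟩
  have hmono' : ∀ s s', 0 < s → s ≤ s' → s' < t₀ → {x | (x, s) ∈ C} ⊆ {x | (x, s') ∈ C} := by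
    intro s s' hs hss' hs'
    rcases hss'.eq_or_lt with rfl | h
    · exact Subset.rfl
    · exact hmono s s' hs h hs'
  have hCc : IsCompact C := Metric.isCompact_of_isClosed_isBounded hCclosed hCbdd
  have hslice : ∀ s, IsClosed {x : Fin k → ℝ | (x, s) ∈ C} := fun s =>
    hCclosed.preimage (by fun_prop)
  have hslicec : ∀ s, IsCompact {x : Fin k → ℝ | (x, s) ∈ C} := fun s =>
    (hCc.image continuous_fst).of_isClosed_subset (hslice s) fun x hx => ⟨(x, s), hx, rfl⟩
  have hBmem : ∀ x, x ∈ B ↔ ∀ᶠ t in nhdsWithin (0 : ℝ) (Ioi 0), (x, t) ∈ C := by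
    intro x
    rw [hB, mem_iInter₂]
    constructor
    · intro h
      filter_upwards [Ioo_mem_nhdsGT ht₀] with t ht using h t ht
    · intro h t ht
      obtain ⟨s, hs, hs'⟩ := (h.and (Ioo_mem_nhdsGT ht.1)).exists
      exact hmono' s t hs'.1 hs'.2.le ht.2 hs
  have hBe : IsNeighbourhoodExtensor B := by
    set Q : Fin n → Polynomial (MvPolynomial (Fin k) ℝ) := fun i =>
      aeval (Fin.snoc (fun j => Polynomial.C (X j)) Polynomial.X) (A i) with hQ
    have hQe : ∀ i x t, ((Q i).map (eval x)).eval t = e i (x, t) := by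
      intro i x t
      exact map_aeval_snoc ((Polynomial.evalRingHom t).comp (Polynomial.mapRingHom (eval x)))
        (fun r => by simp [Polynomial.algebraMap_apply, algebraMap_eq]) (by simp) (by simp) (A i)
    refine isNeighbourhoodExtensor_of_sign_determined
      (Finset.univ.biUnion fun i => (Q i).coeffs ∪ {0}) ?_ ?_
    · rw [hB]
      exact isClosed_biInter fun s _ => hslice s
    · intro x y hxy hx
      rw [hBmem] at hx ⊢
      have hall : ∀ᶠ t in nhdsWithin (0 : ℝ) (Ioi 0), ∀ i,
          SignType.sign (e i (x, t)) = SignType.sign (e i (y, t)) := by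
        refine Filter.eventually_all.mpr fun i => ?_
        simp only [← hQe]
        refine eventually_sign_eval_eq_of_sign_coeff_eq (Q i).natDegree _ _
          Polynomial.natDegree_map_le Polynomial.natDegree_map_le fun m => ?_
        rw [Polynomial.coeff_map, Polynomial.coeff_map]
        refine hxy _ (Finset.mem_biUnion.mpr ⟨i, Finset.mem_univ i, ?_⟩)
        by_cases h0 : (Q i).coeff m = 0
        · simp [h0]
        · exact Finset.mem_union_left _ (Polynomial.coeff_mem_coeffs h0)
      filter_upwards [hx, hall] with t hxt ht
      rw [hmem] at hxt ⊢
      rwa [← funext ht]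
  have hev : ∀ i p, evalPoint p (aeval (Fin.snoc X (MvPolynomial.C Polynomial.X)) (A i)) = e i p := fun i p =>
    map_aeval_snoc (evalPoint p)
      (fun r => by simp [MvPolynomial.algebraMap_apply, evalPoint_C])
      (by simp [evalPoint]) (by simp [evalPoint_C]) (A i)
  have hfam := eventually_exists_isFibreRetractFamily
    (Finset.univ.image fun i => aeval (Fin.snoc X (MvPolynomial.C Polynomial.X)) (A i)) hCclosed
    (fun p q hpq hp => by
      rw [hmem] at hp ⊢
      have h : (fun i => SignType.sign (e i p)) = fun i => SignType.sign (e i q) := by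
        funext i
        have := hpq _ (Finset.mem_image_of_mem _ (Finset.mem_univ i))
        rwa [hev, hev] at this
      rwa [← h])
  obtain ⟨t₁, ⟨𝒦, h𝒦, hU⟩, ht₁⟩ := (hfam.and (Ioo_mem_nhdsGT ht₀)).exists
  obtain ⟨H, hHc, hHK, hHd⟩ := h𝒦.exists_transport
  have hU' : ∀ x, ∀ s ∈ Ioo 0 t₁,
      ((x, s) ∈ ⋃₀ (𝒦 : Set (Set ((Fin k → ℝ) × ℝ))) ↔ (x, s) ∈ C) := fun x s hs => by
    rw [hU]
    exact ⟨fun h => h.1, fun h => ⟨h, hs⟩⟩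
  refine ⟨t₁, ht₁, fun t ht => ⟨?_, ?_⟩⟩
  · rw [hB]
    exact biInter_subset_of_mem ⟨ht.1, ht.2.trans ht₁.2⟩
  have hlt : ∀ s ∈ Ioc 0 t, s ∈ Ioo 0 t₁ := fun s hs => ⟨hs.1, hs.2.trans_lt ht.2⟩
  refine exists_homotopyEquiv_of_transport (C := fun s => {x | (x, s) ∈ C}) ht.1
    (fun s s' hs hss' hs' => hmono' s s' hs hss' (hs'.trans_lt (ht.2.trans ht₁.2)))
    hslicec ?_ hBe ?_ H ?_ ?_ ?_
  · refine subset_antisymm (subset_iInter₂ fun s hs => ?_) fun x hx => ?_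
    · rw [hB]
      exact biInter_subset_of_mem ⟨hs.1, (hlt s hs).2.trans ht₁.2⟩
    · rw [hBmem]
      filter_upwards [Ioo_mem_nhdsGT ht.1] with s hs
      exact mem_iInter₂.mp hx s ⟨hs.1, hs.2.le⟩
  · convert h𝒦.isNeighbourhoodExtensor_slice ht using 1
    ext x
    exact (hU' x t ht).symm
  · refine hHc.mono ?_
    rintro ⟨⟨x, τ⟩, s⟩ ⟨hτ, hs, hx⟩
    exact ⟨(hU' x τ (hlt τ hτ)).mpr hx, hlt s hs⟩
  · intro x τ hτ s hs hx
    obtain ⟨K, hK, hxK⟩ := (hU' x τ (hlt τ hτ)).mpr hx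
    exact (hU' _ s (hlt s hs)).mp ⟨K, hK, hHK K hK _ hxK s (hlt s hs)⟩
  · exact fun x τ hτ hx => hHd _ ((hU' x τ (hlt τ hτ)).mpr hx)
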